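/- arXiv:2502.10710 — 5 statements merged into one kernel-verified Lean document; each statement's English description precedes it below -/
import Mathlib

section
/- Suppose there exists a (v,m,k,λ)-SEDF in a finite abelian group G with m ≥ 3. Let d > 2 be an integer dividing exp(G), and let λ' be a divisor of λ such that λ' is self-conjugate modulo d and gcd(λ',d) = 1. Then there exists a positive divisor c of λ' such that λ' ≤ c² and c ≤ 2^{t−1}·v/d, where t is the number of distinct prime divisors of d. -/
/-- A `(v,m,k,λ)`-strong external difference family in a finite abelian group `G`. -/
def IsSEDF {G : Type*} [CommGroup G] [Fintype G] [DecidableEq G]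
    {m : ℕ} (D : Fin m → Finset G) (k lam : ℕ) : Prop :=
  0 < m ∧ 0 < k ∧ 0 < lam ∧
  (∀ i, (D i).card = k) ∧
  (∀ i j, i ≠ j → Disjoint (D i) (D j)) ∧
  ∀ j : Fin m, ∀ g : G,
    (∑ l ∈ Finset.univ.filter (fun l => l ≠ j),
      (((D l) ×ˢ (D j)).filter (fun x => x.1 * x.2⁻¹ = g)).card)
    = if g = 1 then 0 else lam

/-- A prime `p` is self-conjugate modulo `w`: writing `w = p^s · u'` with `gcd(u',p) = 1`,
there exists `r` with `p^r ≡ -1 (mod u')`. -/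
def SelfConjPrime (p w : ℕ) : Prop :=
  ∃ r : ℕ, (p : ZMod (w / p ^ w.factorization p)) ^ r = -1

/-- A positive integer `n` is self-conjugate modulo `w` if all of its prime divisors are. -/
def SelfConjugate (n w : ℕ) : Prop :=
  ∀ p : ℕ, p.Prime → p ∣ n → SelfConjPrime p w

open ComplexConjugate Polynomial

theorem conj_mem_adjoin_singleton {ζ : ℂ} {n : ℕ} (hζ : ζ ^ n = conj ζ) {x : ℂ}
    (hx : x ∈ Algebra.adjoin ℤ {ζ}) : conj x ∈ Algebra.adjoin ℤ {ζ} := by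
  induction hx using Algebra.adjoin_induction with
  | mem y hy =>
    rw [Set.mem_singleton_iff.1 hy, ← hζ]
    exact pow_mem (Algebra.self_mem_adjoin_singleton ℤ ζ) _
  | algebraMap n => simp
  | add a b _ _ ha hb => rw [map_add]; exact add_mem ha hb
  | mul a b _ _ ha hb => rw [map_mul]; exact mul_mem ha hb

theorem exists_pow_prime_pow_eq_conj_add {ζ : ℂ} {p r : ℕ} (hp : p.Prime)
    (hζ : ζ ^ p ^ r = conj ζ) {x : ℂ} (hx : x ∈ Algebra.adjoin ℤ {ζ}) :
    ∃ w ∈ Algebra.adjoin ℤ {ζ}, x ^ p ^ r = conj x + p * w := by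
  induction hx using Algebra.adjoin_induction with
  | mem y hy =>
    rw [Set.mem_singleton_iff.1 hy]
    exact ⟨0, zero_mem _, by simp [hζ]⟩
  | algebraMap n =>
    have hfact := Fact.mk hp
    obtain ⟨k, hk⟩ : (p : ℤ) ∣ n ^ p ^ r - n := by
      rw [← ZMod.intCast_zmod_eq_zero_iff_dvd]
      simp [ZMod.pow_card_pow]
    refine ⟨k, intCast_mem _ k, ?_⟩
    rw [sub_eq_iff_eq_add'] at hk
    simpa using congrArg (Int.cast : ℤ → ℂ) hk
  | add a b ha hb iha ihb =>
    obtain ⟨u, hu, hau⟩ := iha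
    obtain ⟨w, hw, hbw⟩ := ihb
    obtain ⟨s, hs⟩ := exists_add_pow_prime_pow_eq hp
      (⟨a, ha⟩ : Algebra.adjoin ℤ {ζ}) ⟨b, hb⟩ r
    have hs' := congrArg (Subtype.val) hs
    push_cast at hs'
    refine ⟨u + w + a * b * s, add_mem (add_mem hu hw) (mul_mem (mul_mem ha hb) s.2), ?_⟩
    rw [hs', hau, hbw, map_add]
    ring
  | mul a b ha hb iha ihb =>
    obtain ⟨u, hu, hau⟩ := iha
    obtain ⟨w, hw, hbw⟩ := ihb
    refine ⟨u * conj b + conj a * w + p * u * w, ?_, ?_⟩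
    · exact add_mem (add_mem (mul_mem hu (conj_mem_adjoin_singleton hζ hb))
        (mul_mem (conj_mem_adjoin_singleton hζ ha) hw))
        (mul_mem (mul_mem (natCast_mem _ p) hu) hw)
    · rw [mul_pow, hau, hbw, map_mul]
      ring

theorem exists_eq_prime_mul_of_dvd_mul_conj {ζ : ℂ} {p r : ℕ} (hp : p.Prime)
    (hr : r ≠ 0) (hζ : ζ ^ p ^ r = conj ζ) {x : ℂ} (hx : x ∈ Algebra.adjoin ℤ {ζ})
    {n : ℤ} (hn : x * conj x = n) (hpn : (p : ℤ) ∣ n) :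
    ∃ y ∈ Algebra.adjoin ℤ {ζ}, x = p * y := by
  have hxc := conj_mem_adjoin_singleton hζ hx
  set a : Algebra.adjoin ℤ {ζ} := ⟨x, hx⟩ with ha
  set b : Algebra.adjoin ℤ {ζ} := ⟨conj x, hxc⟩ with hb
  have hab : (p : Algebra.adjoin ℤ {ζ}) ∣ a ^ p ^ r - b := by
    obtain ⟨u, hu, hxu⟩ := exists_pow_prime_pow_eq_conj_add hp hζ hx
    exact ⟨⟨u, hu⟩, Subtype.ext (by simp [ha, hb, hxu])⟩
  have hba : (p : Algebra.adjoin ℤ {ζ}) ∣ b ^ p ^ r - a := by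
    obtain ⟨u, hu, hxu⟩ := exists_pow_prime_pow_eq_conj_add hp hζ hxc
    exact ⟨⟨u, hu⟩, Subtype.ext (by simp [ha, hb, hxu])⟩
  have hmul : (p : Algebra.adjoin ℤ {ζ}) ∣ b * a := by
    obtain ⟨k, rfl⟩ := hpn
    exact ⟨(k : Algebra.adjoin ℤ {ζ}), Subtype.ext (by simpa [ha, hb, mul_comm] using hn)⟩
  have hsucc : (p : Algebra.adjoin ℤ {ζ}) ∣ a ^ (p ^ r + 1) := by
    have := dvd_add (hab.mul_right a) hmul
    rwa [← add_mul, sub_add_cancel, ← pow_succ] at this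
  have hle : p ^ r + 1 ≤ p ^ r * p ^ r := by
    have : 2 ≤ p ^ r := hp.two_le.trans (Nat.le_self_pow hr p)
    nlinarith
  have hsq : (p : Algebra.adjoin ℤ {ζ}) ∣ (a ^ p ^ r) ^ p ^ r := by
    rw [← pow_mul]
    exact hsucc.trans (pow_dvd_pow a hle)
  have hpa : (p : Algebra.adjoin ℤ {ζ}) ∣ a := by
    have h1 := (dvd_sub_right hsq).1 (hab.trans (sub_dvd_pow_sub_pow _ _ (p ^ r)))
    exact (dvd_sub_right h1).1 hba
  obtain ⟨y, hy⟩ := hpa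
  exact ⟨y, y.2, by simpa [ha] using congrArg Subtype.val hy⟩

theorem SelfConjPrime.exists_pow_eq_conj {p d : ℕ} (h : SelfConjPrime p d) (hd : 2 < d)
    (hpd : ¬ p ∣ d) {ζ : ℂ} (hζ : IsPrimitiveRoot ζ d) :
    ∃ r ≠ 0, ζ ^ p ^ r = conj ζ := by
  obtain ⟨r, hr⟩ := h
  rw [Nat.factorization_eq_zero_of_not_dvd hpd, pow_zero, Nat.div_one] at hr
  have : Fact (2 < d) := ⟨hd⟩
  refine ⟨r, ?_, ?_⟩
  · rintro rfl
    rw [pow_zero] at hr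
    exact ZMod.neg_one_ne_one hr.symm
  · have hdvd : d ∣ p ^ r + 1 := by
      rw [← ZMod.natCast_eq_zero_iff]
      simp [hr]
    have h1 : ζ ^ p ^ r * ζ = 1 := by
      rw [← pow_succ]
      exact (hζ.pow_eq_one_iff_dvd _).2 hdvd
    rw [eq_inv_of_mul_eq_one_left h1,
      Complex.inv_eq_conj (hζ.norm'_eq_one (by omega))]

theorem exists_int_eq_of_mem_adjoin {d : ℕ} (hd : 0 < d) {ζ : ℂ} (hζ : IsPrimitiveRoot ζ d)
    {x : ℂ} (hx : x ∈ Algebra.adjoin ℤ {ζ}) {q : ℚ} (hq : x = q) : ∃ n : ℤ, x = n := by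
  have hint : IsIntegral ℤ x :=
    adjoin_le_integralClosure (hζ.isIntegral hd) hx
  rw [hq, show (q : ℂ) = algebraMap ℚ ℂ q from rfl,
    isIntegral_algebraMap_iff (algebraMap ℚ ℂ).injective] at hint
  obtain ⟨n, hn⟩ := IsIntegrallyClosed.isIntegral_iff.1 hint
  exact ⟨n, by rw [hq, ← hn]; simp⟩

theorem exists_mul_eq_of_selfConjugate {d : ℕ} (hd : 2 < d) {ζ : ℂ} (hζ : IsPrimitiveRoot ζ d)
    (n : ℕ) : ∀ (lam : ℕ) (x y : ℂ) (a b : ℤ), 0 < lam → n ∣ lam → SelfConjugate n d →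
    n.Coprime d → x ∈ Algebra.adjoin ℤ {ζ} → y ∈ Algebra.adjoin ℤ {ζ} →
    x * conj x = a → y * conj y = b → a * b = (lam : ℤ) ^ 2 →
    ∃ c₁ c₂ : ℕ, c₁ * c₂ = n ∧ (∃ u ∈ Algebra.adjoin ℤ {ζ}, x = c₁ * u) ∧
      ∃ w ∈ Algebra.adjoin ℤ {ζ}, y = c₂ * w := by
  induction n using induction_on_primes with
  | zero => intro lam _ _ _ _ hpos hdvd; simp_all
  | one =>
    intro _ x y _ _ _ _ _ _ hx hy _ _ _
    exact ⟨1, 1, rfl, ⟨x, hx, by simp⟩, y, hy, by simp⟩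
  | prime_mul p n hp ih =>
    intro lam x y a b hpos hdvd hsc hcop hx hy hxa hyb hab
    have hp0 : (p : ℤ) ≠ 0 := by exact_mod_cast hp.ne_zero
    have hpC : (p : ℂ) ≠ 0 := by exact_mod_cast hp.ne_zero
    have hpd : ¬ p ∣ d := (Nat.Prime.coprime_iff_not_dvd hp).1 hcop.coprime_mul_right
    obtain ⟨r, hr, hζr⟩ := (hsc p hp (dvd_mul_right p n)).exists_pow_eq_conj hd hpd hζ
    obtain ⟨l, rfl⟩ := (dvd_mul_right p n).trans hdvd
    have hn : n ∣ l := Nat.dvd_of_mul_dvd_mul_left hp.pos hdvd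
    have hl : 0 < l := Nat.pos_of_mul_pos_left hpos
    have hsc' : SelfConjugate n d := fun q hq hqn => hsc q hq (hqn.mul_left p)
    have hcop' : n.Coprime d := hcop.coprime_mul_left
    have step : ∀ {x : ℂ} {a b : ℤ}, x ∈ Algebra.adjoin ℤ {ζ} → x * conj x = a →
        a * b = ((p * l : ℕ) : ℤ) ^ 2 → (p : ℤ) ∣ a →
        ∃ x' ∈ Algebra.adjoin ℤ {ζ}, x = p * x' ∧ ∃ a' : ℤ, x' * conj x' = a' ∧
          a' * b = (l : ℤ) ^ 2 := by
      intro x a b hx hxa hab hpa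
      obtain ⟨x', hx', rfl⟩ := exists_eq_prime_mul_of_dvd_mul_conj hp hr hζr hx hxa hpa
      have hrat : ∃ a' : ℤ, x' * conj x' = a' := by
        have hmem := mul_mem hx' (conj_mem_adjoin_singleton hζr hx')
        refine exists_int_eq_of_mem_adjoin (by omega) hζ hmem (q := a / p ^ 2) ?_
        push_cast
        rw [← hxa, map_mul, Complex.conj_natCast]
        field_simp
      obtain ⟨a', ha'⟩ := hrat
      refine ⟨x', hx', rfl, a', ha', ?_⟩
      have haa' : a = p ^ 2 * a' := by
        rw [map_mul, Complex.conj_natCast] at hxa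
        have : (a : ℂ) = ((p ^ 2 * a' : ℤ) : ℂ) := by
          rw [← hxa]
          push_cast
          rw [← ha']
          ring
        exact_mod_cast this
      apply mul_left_cancel₀ (pow_ne_zero 2 hp0)
      rw [← mul_assoc, ← haa', hab]
      push_cast
      ring
    have hpab : (p : ℤ) ∣ a * b := by
      rw [hab]
      push_cast
      exact Dvd.intro_left (p * l ^ 2 : ℤ) (by ring)
    rcases (Nat.prime_iff_prime_int.1 hp).dvd_or_dvd hpab with hpa | hpb
    · obtain ⟨x', hx', rfl, a', ha', hab'⟩ := step hx hxa hab hpa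
      obtain ⟨c₁, c₂, rfl, ⟨u, hu, rfl⟩, hw⟩ :=
        ih l x' y a' b hl hn hsc' hcop' hx' hy ha' hyb hab'
      exact ⟨p * c₁, c₂, by ring, ⟨u, hu, by push_cast; ring⟩, hw⟩
    · obtain ⟨y', hy', rfl, b', hb', hab'⟩ := step hy hyb ((mul_comm b a).trans hab) hpb
      obtain ⟨c₁, c₂, rfl, hu, w, hw, rfl⟩ :=
        ih l x y' a b' hl hn hsc' hcop' hx hy' hxa hb' ((mul_comm a b').trans hab')
      exact ⟨c₁, p * c₂, by ring, hu, w, hw, by push_cast; ring⟩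

theorem exists_mul_conj_eq_rat {ι : Type*} [Fintype ι] (hι : 3 ≤ Fintype.card ι) {lam : ℕ}
    (hlam : 0 < lam) (a : ι → ℂ) (h : ∀ j, (∑ i, a i - a j) * conj (a j) = -lam) :
    ∃ i j, ∃ p q : ℚ, a i * conj (a i) = p ∧ a j * conj (a j) = q ∧ p * q = lam ^ 2 := by
  have hlam' : (0 : ℝ) < lam := by exact_mod_cast hlam
  set z := ∑ i, a i with hz
  by_cases hz0 : z = 0
  · obtain ⟨j⟩ : Nonempty ι := Fintype.card_pos_iff.1 (by omega)
    have hj : a j * conj (a j) = ((lam : ℚ) : ℂ) := by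
      have := h j
      rw [hz0] at this
      push_cast
      linear_combination -this
    exact ⟨j, j, lam, lam, hj, hj, by ring⟩
  set N := Complex.normSq z with hN
  have hNpos : 0 < N := Complex.normSq_pos.2 hz0
  have hNz : z * conj z = N := Complex.mul_conj z
  have hNC : (N : ℂ) ≠ 0 := by exact_mod_cast hNpos.ne'
  set α : ι → ℝ := fun j => (Complex.normSq (a j) - lam) / N with hα
  have haα (j : ι) : a j = α j * z := by
    have h1 : z * conj (a j) = (Complex.normSq (a j) : ℂ) - lam := by
      rw [← Complex.mul_conj]
      linear_combination h j
    have h2 := congrArg conj h1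
    simp only [map_mul, Complex.conj_conj, map_sub, Complex.conj_ofReal, map_natCast] at h2
    simp only [hα]
    push_cast
    field_simp
    rw [← h2, ← hNz]
    ring
  have hnorm (j : ι) : Complex.normSq (a j) = α j ^ 2 * N := by
    rw [haα j, Complex.normSq_mul, Complex.normSq_ofReal, hN]
    ring
  have hquad (j : ι) : α j ^ 2 * N = α j * N + lam := by
    have : α j * N = Complex.normSq (a j) - lam := div_mul_cancel₀ _ hNpos.ne'
    rw [this, ← hnorm j]
    ring
  have hsum : ∑ j, α j = 1 := by
    have : (∑ j, (α j : ℂ)) * z = 1 * z := by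
      rw [Finset.sum_mul, one_mul, hz]
      exact Finset.sum_congr rfl fun j _ => (haα j).symm
    exact_mod_cast mul_right_cancel₀ hz0 this
  obtain ⟨i⟩ : Nonempty ι := Fintype.card_pos_iff.1 (by omega)
  set t := 2 * α i - 1 with ht
  have ht2 : t ^ 2 * N = N + 4 * lam := by
    rw [ht]
    linear_combination 4 * hquad i
  have ht1 : 1 < t ^ 2 := by
    by_contra! hle
    nlinarith
  have hpm (j : ι) : 2 * α j - 1 = t ∨ 2 * α j - 1 = -t := by
    apply sq_eq_sq_iff_eq_or_eq_neg.1
    apply mul_right_cancel₀ hNpos.ne'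
    rw [ht2]
    linear_combination 4 * hquad j
  have hcard : (3 : ℝ) ≤ Fintype.card ι := by exact_mod_cast hι
  have hsum2 : ∑ j, (2 * α j - 1) = 2 - Fintype.card ι := by
    simp [Finset.sum_sub_distrib, ← Finset.mul_sum, hsum]
  obtain ⟨j, hj⟩ : ∃ j, 2 * α j - 1 = -t := by
    by_contra! hne
    have hall : ∀ j, 2 * α j - 1 = t := fun j => (hpm j).resolve_right (hne j)
    simp only [hall, Finset.sum_const, Finset.card_univ, nsmul_eq_mul] at hsum2
    have hlow : -1 ≤ t := by nlinarith
    have hupp : t ≤ 1 := by nlinarith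
    nlinarith
  have hsign (j : ι) : ∃ ε : ℤ, 2 * α j - 1 = ε * t := by
    rcases hpm j with hj | hj
    · exact ⟨1, by simpa using hj⟩
    · exact ⟨-1, by simpa using hj⟩
  choose ε hε using hsign
  obtain ⟨s, hs⟩ : ∃ s : ℚ, t = s := by
    refine ⟨(2 - Fintype.card ι) / (∑ j, ε j : ℤ), ?_⟩
    simp only [hε, ← Finset.sum_mul] at hsum2
    push_cast
    have hne : (∑ j, (ε j : ℝ)) ≠ 0 := by
      intro h0
      rw [h0] at hsum2
      linarith
    field_simp
    linarith
  have hαi : α i = (((1 + s) / 2 : ℚ) : ℝ) := by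
    push_cast
    linarith
  have hαj : α j = (((1 - s) / 2 : ℚ) : ℝ) := by
    push_cast
    linarith
  have hs1 : (s : ℝ) ^ 2 - 1 ≠ 0 := by rw [← hs]; linarith
  have hNs : N = ((4 * lam / (s ^ 2 - 1) : ℚ) : ℝ) := by
    push_cast
    rw [eq_div_iff hs1, ← hs]
    linarith
  refine ⟨i, j, ((1 + s) / 2) ^ 2 * (4 * lam / (s ^ 2 - 1)),
    ((1 - s) / 2) ^ 2 * (4 * lam / (s ^ 2 - 1)), ?_, ?_, ?_⟩
  · rw [Complex.mul_conj, hnorm, hαi, hNs]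
    push_cast
    ring
  · rw [Complex.mul_conj, hnorm, hαj, hNs]
    push_cast
    ring
  · have : s ^ 2 - 1 ≠ 0 := by exact_mod_cast hs1
    field_simp
    ring

theorem X_pow_sub_one_dvd_cyclotomic_mul_prod {d : ℕ} (hd : 0 < d) :
    (X ^ d - 1 : ℤ[X]) ∣ cyclotomic d ℤ * ∏ p ∈ d.primeFactors, (X ^ (d / p) - 1) := by
  rw [← prod_cyclotomic_eq_X_pow_sub_one hd, ← Nat.cons_self_properDivisors hd.ne',
    Finset.prod_cons]
  refine mul_dvd_mul_left _ (Finset.prod_dvd_of_isRelPrime ?_ ?_)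
  · intro i hi j hj hij
    have hi0 := Nat.pos_of_mem_properDivisors hi
    have hj0 := Nat.pos_of_mem_properDivisors hj
    refine ((cyclotomic.irreducible hi0).isRelPrime_iff_not_dvd).2 fun hdvd => hij ?_
    exact cyclotomic_injective (eq_of_monic_of_associated (cyclotomic.monic i ℤ)
      (cyclotomic.monic j ℤ) ((cyclotomic.irreducible hi0).associated_of_dvd
        (cyclotomic.irreducible hj0) hdvd))
  · intro e he
    obtain ⟨⟨k, rfl⟩, hlt⟩ := Nat.mem_properDivisors.1 he
    have hk1 : k ≠ 1 := by rintro rfl; simp at hlt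
    obtain ⟨p, hp, m, rfl⟩ := Nat.exists_prime_and_dvd hk1
    have hmem : p ∈ (e * (p * m)).primeFactors :=
      Nat.mem_primeFactors.2 ⟨hp, ⟨e * m, by ring⟩, hd.ne'⟩
    refine dvd_trans ?_ (Finset.dvd_prod_of_mem _ hmem)
    have : e * (p * m) / p = e * m := by
      rw [show e * (p * m) = e * m * p by ring, Nat.mul_div_cancel _ hp.pos]
    rw [this]
    refine (cyclotomic.dvd_X_pow_sub_one e ℤ).trans ?_
    rw [pow_mul]
    simpa using sub_dvd_pow_sub_pow (X ^ e : ℤ[X]) 1 m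

/-- Translation by one on integer-valued functions on `ZMod d`. -/
def cyclicShift (d : ℕ) : Module.End ℤ (ZMod d → ℤ) :=
  LinearMap.funLeft ℤ ℤ fun i => i - 1

theorem cyclicShift_pow_apply {d : ℕ} (n : ℕ) (F : ZMod d → ℤ) (i : ZMod d) :
    (cyclicShift d ^ n) F i = F (i - n) := by
  induction n generalizing i with
  | zero => simp
  | succ n ih =>
    rw [pow_succ', Module.End.mul_apply]
    change ((cyclicShift d ^ n) F) (i - 1) = _
    rw [ih]
    congr 1
    push_cast
    ring

theorem aeval_cyclicShift_X_pow_sub_one_apply {d : ℕ} (n : ℕ) (F : ZMod d → ℤ) (i : ZMod d) :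
    aeval (cyclicShift d) (X ^ n - 1 : ℤ[X]) F i = F (i - n) - F i := by
  simp [cyclicShift_pow_apply]

theorem aeval_cyclicShift_prod_sub_le {d : ℕ} (e : ℕ → ℕ) {F : ZMod d → ℤ} {W : ℤ}
    (hF : ∀ i j, F i - F j ≤ W) (s : Finset ℕ) (i j : ZMod d) :
    aeval (cyclicShift d) (∏ p ∈ s, (X ^ e p - 1) : ℤ[X]) F i -
      aeval (cyclicShift d) (∏ p ∈ s, (X ^ e p - 1) : ℤ[X]) F j ≤ 2 ^ s.card * W := by
  induction s using Finset.induction_on generalizing i j with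
  | empty =>
    simpa only [Finset.prod_empty, map_one, Module.End.one_apply, Finset.card_empty, pow_zero,
      one_mul] using hF i j
  | insert p s hp ih =>
    rw [Finset.prod_insert hp, Finset.card_insert_of_notMem hp, map_mul, Module.End.mul_apply,
      aeval_cyclicShift_X_pow_sub_one_apply, aeval_cyclicShift_X_pow_sub_one_apply, pow_succ]
    linarith [ih (i - e p) i, ih j (j - e p)]

theorem abs_aeval_cyclicShift_prod_le {d : ℕ} (e : ℕ → ℕ) {F : ZMod d → ℤ} {W : ℤ}
    (hF : ∀ i j, F i - F j ≤ W) {s : Finset ℕ} (hs : s.Nonempty) (i : ZMod d) :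
    |aeval (cyclicShift d) (∏ p ∈ s, (X ^ e p - 1) : ℤ[X]) F i| ≤ 2 ^ (s.card - 1) * W := by
  obtain ⟨p, hp⟩ := hs
  rw [← Finset.mul_prod_erase s _ hp, ← Finset.card_erase_of_mem hp, map_mul,
    Module.End.mul_apply, aeval_cyclicShift_X_pow_sub_one_apply, abs_le]
  constructor <;> linarith [aeval_cyclicShift_prod_sub_le e hF (s.erase p) i (i - e p),
    aeval_cyclicShift_prod_sub_le e hF (s.erase p) (i - e p) i]

theorem IsPrimitiveRoot.pow_zmod_val_add_natCast {d : ℕ} {ζ : ℂ} (hζ : IsPrimitiveRoot ζ d)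
    [NeZero d] (i : ZMod d) (n : ℕ) : ζ ^ (i + n).val = ζ ^ n * ζ ^ i.val := by
  rw [← pow_add, pow_eq_pow_mod _ hζ.pow_eq_one, pow_eq_pow_mod (n + i.val) hζ.pow_eq_one]
  congr 1
  apply (ZMod.natCast_eq_natCast_iff _ _ d).1
  simp [add_comm]

theorem sum_aeval_cyclicShift_mul_pow {d : ℕ} [NeZero d] {ζ : ℂ} (hζ : IsPrimitiveRoot ζ d)
    (F : ZMod d → ℤ) (f : ℤ[X]) :
    ∑ i, (aeval (cyclicShift d) f F i : ℂ) * ζ ^ i.val =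
      aeval ζ f * ∑ i, (F i : ℂ) * ζ ^ i.val := by
  induction f using Polynomial.induction_on' with
  | add f g hf hg =>
    simp only [map_add, LinearMap.add_apply, Pi.add_apply, Int.cast_add, add_mul,
      Finset.sum_add_distrib, hf, hg]
  | monomial n a =>
    have : ∑ i, ((cyclicShift d ^ n) F i : ℂ) * ζ ^ i.val =
        ζ ^ n * ∑ i, (F i : ℂ) * ζ ^ i.val := by
      rw [← Equiv.sum_comp (Equiv.addRight (n : ZMod d)), Finset.mul_sum]
      refine Finset.sum_congr rfl fun i _ => ?_
      rw [cyclicShift_pow_apply, Equiv.coe_addRight, add_sub_cancel_right,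
        hζ.pow_zmod_val_add_natCast]
      ring
    simp only [aeval_monomial, Module.End.mul_apply, Module.algebraMap_end_apply, Pi.smul_apply,
      smul_eq_mul, Int.cast_mul, mul_assoc, ← Finset.mul_sum, this]
    simp

theorem le_two_pow_mul_of_sum_eq_mul {d : ℕ} [NeZero d] (hd : 2 ≤ d) {ζ : ℂ}
    (hζ : IsPrimitiveRoot ζ d) {F : ZMod d → ℤ} {W : ℤ} (hF0 : ∀ i, 0 ≤ F i)
    (hFW : ∀ i, F i ≤ W) {c : ℕ} {y : ℂ} (hy : y ∈ Algebra.adjoin ℤ {ζ})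
    (hsum : ∑ i, (F i : ℂ) * ζ ^ i.val = c * y) (hne : ∑ i, (F i : ℂ) * ζ ^ i.val ≠ 0) :
    (c : ℤ) ≤ 2 ^ (d.primeFactors.card - 1) * W := by
  have hd0 : 0 < d := by omega
  rw [Algebra.adjoin_singleton_eq_range_aeval] at hy
  obtain ⟨g, rfl⟩ := hy
  set Q : ℤ[X] := ∏ p ∈ d.primeFactors, (X ^ (d / p) - 1) with hQ
  set f : ℤ[X] := ∑ i : ZMod d, C (F i) * X ^ i.val with hf
  set δ : ZMod d → ℤ := Pi.single 0 1 with hδ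
  have hfF : aeval (cyclicShift d) f δ = F := by
    ext j
    simp only [hf, map_sum, map_mul, aeval_C, map_pow, aeval_X, LinearMap.sum_apply,
      Module.End.mul_apply, Module.algebraMap_end_apply, Finset.sum_apply, Pi.smul_apply,
      cyclicShift_pow_apply, ZMod.natCast_zmod_val, hδ, Pi.single_apply, sub_eq_zero]
    simp
  obtain ⟨h, hh⟩ : cyclotomic d ℤ ∣ f - C (c : ℤ) * g := by
    rw [cyclotomic_eq_minpoly hζ hd0]
    apply minpoly.isIntegrallyClosed_dvd (hζ.isIntegral hd0)
    have : aeval ζ f = ∑ i, (F i : ℂ) * ζ ^ i.val := by simp [hf]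
    rw [map_sub, this, hsum]
    simp
  obtain ⟨k, hk⟩ := X_pow_sub_one_dvd_cyclotomic_mul_prod hd0
  have hker : aeval (cyclicShift d) (X ^ d - 1 : ℤ[X]) = 0 := by
    refine LinearMap.ext fun G => funext fun i => ?_
    rw [aeval_cyclicShift_X_pow_sub_one_apply]
    simp
  have hB : aeval (cyclicShift d) Q F = (c : ℤ) • aeval (cyclicShift d) (Q * g) δ := by
    have hQf : Q * f = C (c : ℤ) * (Q * g) + k * h * (X ^ d - 1) := by
      linear_combination Q * hh + h * hk
    rw [← hfF, ← Module.End.mul_apply, ← map_mul, hQf, map_add, map_mul _ (k * h), hker,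
      mul_zero, add_zero, map_mul, aeval_C]
    rfl
  have hEne : ∑ i, (aeval (cyclicShift d) Q F i : ℂ) * ζ ^ i.val ≠ 0 := by
    rw [sum_aeval_cyclicShift_mul_pow hζ]
    refine mul_ne_zero ?_ hne
    rw [hQ, map_prod, Finset.prod_ne_zero_iff]
    intro p hp
    have hpp := Nat.prime_of_mem_primeFactors hp
    have := hζ.pow_ne_one_of_pos_of_lt
      (Nat.div_pos (Nat.le_of_mem_primeFactors hp) hpp.pos).ne' (Nat.div_lt_self hd0 hpp.one_lt)
    simpa [sub_eq_zero] using this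
  obtain ⟨i, -, hi⟩ := Finset.exists_ne_zero_of_sum_ne_zero hEne
  have hi0 : aeval (cyclicShift d) Q F i ≠ 0 := by
    intro h0
    simp [h0] at hi
  have hdvd : (c : ℤ) ∣ aeval (cyclicShift d) Q F i :=
    ⟨aeval (cyclicShift d) (Q * g) δ i, by rw [hB]; rfl⟩
  calc (c : ℤ) ≤ |aeval (cyclicShift d) Q F i| :=
        Int.le_of_dvd (abs_pos.2 hi0) ((dvd_abs _ _).2 hdvd)
    _ ≤ _ := abs_aeval_cyclicShift_prod_le _ (fun i j => by linarith [hF0 j, hFW i])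
        (Nat.nonempty_primeFactors.2 (by omega)) i

theorem exists_monoidHom_isPrimitiveRoot {G : Type*} [CommGroup G] [Finite G] {d : ℕ}
    (hd : d ∣ Monoid.exponent G) :
    ∃ (χ : G →* ℂˣ) (g : G), IsPrimitiveRoot (χ g) d ∧ ∀ x, (χ x) ^ d = 1 := by
  have hexp0 : Monoid.exponent G ≠ 0 := Monoid.exponent_ne_zero_of_finite
  have : NeZero (Monoid.exponent G) := ⟨hexp0⟩
  have e := (CommGroup.monoidHom_mulEquiv_of_hasEnoughRootsOfUnity G ℂ).some
  have hfin : Finite (G →* ℂˣ) := Finite.of_equiv G e.symm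
  obtain ⟨ψ, hψ⟩ := Monoid.exists_orderOf_eq_exponent
    (Monoid.ExponentExists.of_finite (G := G →* ℂˣ))
  rw [Monoid.exponent_eq_of_mulEquiv e] at hψ
  rw [← hψ] at hd hexp0
  set χ := ψ ^ (orderOf ψ / d) with hχ
  have hχd : orderOf χ = d := orderOf_pow_orderOf_div hexp0 hd
  have hpow (x : G) : χ x ^ d = 1 := by
    rw [← MonoidHom.pow_apply, ← hχd, pow_orderOf_eq_one, MonoidHom.one_apply]
  have : Finite χ.range := Set.finite_range χ
  obtain ⟨⟨_, g, rfl⟩, hg⟩ := IsCyclic.exists_monoid_generator (α := χ.range)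
  refine ⟨χ, g, ?_, hpow⟩
  refine IsPrimitiveRoot.iff_def _ _ |>.2 ⟨hpow g, fun l hl => ?_⟩
  rw [← hχd]
  apply orderOf_dvd_of_pow_eq_one
  ext x
  obtain ⟨n, hn⟩ := Submonoid.mem_powers_iff _ _ |>.1 (hg ⟨χ x, x, rfl⟩)
  have hn' : χ g ^ n = χ x := congrArg Subtype.val hn
  rw [MonoidHom.pow_apply, ← hn', pow_right_comm, hl]
  simp

theorem IsSEDF.sum_sub_mul_conj {G : Type*} [CommGroup G] [Fintype G] [DecidableEq G] {m : ℕ}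
    {D : Fin m → Finset G} {k lam : ℕ} (h : IsSEDF D k lam) {χ : G →* ℂˣ} (hχ : χ ≠ 1)
    (j : Fin m) :
    (∑ i, ∑ g ∈ D i, (χ g : ℂ) - ∑ g ∈ D j, (χ g : ℂ)) * conj (∑ g ∈ D j, (χ g : ℂ)) =
      -lam := by
  have hconj (g : G) : conj (χ g : ℂ) = χ g⁻¹ := by
    rw [map_inv, Units.val_inv_eq_inv_val, Complex.inv_eq_conj]
    refine Complex.norm_eq_one_of_pow_eq_one (n := Fintype.card G) ?_ Fintype.card_ne_zero
    rw [← Units.val_pow_eq_pow_val, ← map_pow, pow_card_eq_one, map_one, Units.val_one]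
  have hsum0 : ∑ g : G, (χ g : ℂ) = 0 := by
    refine sum_hom_units_eq_zero ((Units.coeHom ℂ).comp χ) fun h1 => hχ ?_
    ext g
    exact DFunLike.congr_fun h1 g
  have hmain : ∑ l ∈ Finset.univ.filter (fun l => l ≠ j), ∑ x ∈ D l ×ˢ D j,
      (χ (x.1 * x.2⁻¹) : ℂ) = -lam := by
    calc _ = ∑ l ∈ Finset.univ.filter (fun l => l ≠ j), ∑ g : G,
          ((((D l) ×ˢ (D j)).filter (fun x => x.1 * x.2⁻¹ = g)).card : ℂ) * χ g := by
          refine Finset.sum_congr rfl fun l _ => ?_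
          rw [← Finset.sum_fiberwise (D l ×ˢ D j) (fun x => x.1 * x.2⁻¹)]
          refine Finset.sum_congr rfl fun g _ => ?_
          rw [Finset.sum_congr rfl fun x hx => by rw [(Finset.mem_filter.1 hx).2],
            Finset.sum_const, nsmul_eq_mul]
      _ = ∑ g : G, ((if g = 1 then 0 else lam : ℕ) : ℂ) * χ g := by
          rw [Finset.sum_comm]
          refine Finset.sum_congr rfl fun g _ => ?_
          rw [← h.2.2.2.2.2 j g]
          push_cast
          rw [Finset.sum_mul]
      _ = ∑ g : G, ((lam : ℂ) * χ g - if g = 1 then (lam : ℂ) else 0) := by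
          refine Finset.sum_congr rfl fun g _ => ?_
          split_ifs with hg <;> simp [hg]
      _ = -lam := by
          rw [Finset.sum_sub_distrib, ← Finset.mul_sum, hsum0]
          simp
  rw [← hmain, Finset.filter_ne', ← Finset.sum_erase_eq_sub (Finset.mem_univ j), Finset.sum_mul]
  refine Finset.sum_congr rfl fun l _ => ?_
  rw [map_sum, Finset.sum_mul_sum, Finset.sum_product]
  simp [hconj]

/-- A divisor `c` of a nonzero character sum of order `d` is at most `2 ^ (t - 1) * v / d`. -/
theorem le_of_sum_character_eq_mul {G : Type*} [CommGroup G] [Fintype G]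
    {d : ℕ} (hd : 2 ≤ d) {χ : G →* ℂˣ} {g₀ : G} (hζ : IsPrimitiveRoot (χ g₀ : ℂ) d)
    (hpow : ∀ x, χ x ^ d = 1) (D : Finset G) (hne : ∑ g ∈ D, (χ g : ℂ) ≠ 0) {c : ℕ} {y : ℂ}
    (hy : y ∈ Algebra.adjoin ℤ {(χ g₀ : ℂ)}) (hc : ∑ g ∈ D, (χ g : ℂ) = c * y) :
    (c : ℝ) ≤ 2 ^ (d.primeFactors.card - 1) * Fintype.card G / d := by
  have : NeZero d := ⟨by omega⟩
  have hexists (x : G) : ∃ i : ZMod d, (χ g₀ : ℂ) ^ i.val = χ x := by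
    obtain ⟨n, hn, hx⟩ := hζ.eq_pow_of_pow_eq_one (ξ := (χ x : ℂ)) 
      (by rw [← Units.val_pow_eq_pow_val, hpow, Units.val_one])
    exact ⟨n, by rw [ZMod.val_natCast_of_lt hn, hx]⟩
  choose e he using hexists
  set F : ZMod d → ℤ := fun i => (D.filter fun g => e g = i).card with hF
  have hFsum : ∑ i, (F i : ℂ) * (χ g₀ : ℂ) ^ i.val = ∑ g ∈ D, (χ g : ℂ) := by
    rw [← Finset.sum_fiberwise D e]
    refine Finset.sum_congr rfl fun i _ => ?_
    rw [Finset.sum_congr rfl fun x hx => by rw [← he x, (Finset.mem_filter.1 hx).2],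
      Finset.sum_const, nsmul_eq_mul]
    simp [hF]
  have hFle (i : ZMod d) : F i ≤ (Fintype.card G / d : ℕ) := by
    simp only [hF, Nat.cast_le]
    rw [Nat.le_div_iff_mul_le (by omega)]
    let φ : ZMod d × {g // g ∈ D.filter fun g => e g = i} → G := fun x => g₀ ^ x.1.val * x.2
    have hφ : Function.Injective φ := by
      rintro ⟨a, g, hg⟩ ⟨b, g', hg'⟩ hab
      have hab' : g₀ ^ a.val * g = g₀ ^ b.val * g' := hab
      have hχ := congrArg (fun x => (χ x : ℂ)) hab'
      simp only [map_mul, map_pow, Units.val_mul, Units.val_pow_eq_pow_val] at hχ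
      rw [← he g, ← he g', (Finset.mem_filter.1 hg).2, (Finset.mem_filter.1 hg').2] at hχ
      have hpw := mul_right_cancel₀ (pow_ne_zero _ (χ g₀).ne_zero) hχ
      have hav : a = b := ZMod.val_injective d
        (hζ.pow_inj (ZMod.val_lt a) (ZMod.val_lt b) hpw)
      subst hav
      simpa using hab'
    have := Fintype.card_le_of_injective φ hφ
    rw [Fintype.card_prod, ZMod.card, Fintype.card_coe] at this
    rwa [mul_comm]
  have hle := le_two_pow_mul_of_sum_eq_mul hd hζ (fun i => by positivity) hFle hy
    (hFsum.trans hc) (hFsum ▸ hne)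
  calc (c : ℝ) ≤ 2 ^ (d.primeFactors.card - 1) * ((Fintype.card G / d : ℕ) : ℝ) := by
        exact_mod_cast hle
    _ ≤ 2 ^ (d.primeFactors.card - 1) * (Fintype.card G / d) := by
        gcongr
        exact Nat.cast_div_le
    _ = _ := by ring

/-- Exponent bound: if there is a `(v,m,k,λ)`-SEDF in `G` with `m ≥ 3`, `d > 2` divides
`exp(G)`, and `λ'` is a divisor of `λ` that is self-conjugate modulo `d` with
`gcd(λ',d) = 1`, then some divisor `c` of `λ'` satisfies `√λ' ≤ c ≤ 2^{t-1}·v/d`,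
where `t` is the number of distinct prime divisors of `d`. -/
theorem sedf_exponent_bound {G : Type*} [CommGroup G] [Fintype G] [DecidableEq G]
    {v m k lam : ℕ} (hv : Fintype.card G = v)
    (D : Fin m → Finset G) (h : IsSEDF D k lam) (hm : 3 ≤ m)
    (d : ℕ) (hd : 2 < d) (hdexp : d ∣ Monoid.exponent G)
    (lam' : ℕ) (hdvd : lam' ∣ lam) (hsc : SelfConjugate lam' d)
    (hgcd : Nat.Coprime lam' d) :
    ∃ c : ℕ, 0 < c ∧ c ∣ lam' ∧ lam' ≤ c ^ 2 ∧
      (c : ℝ) ≤ 2 ^ (d.primeFactors.card - 1) * v / d := by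
  subst hv
  obtain ⟨χ, g₀, hχ, hpow⟩ := exists_monoidHom_isPrimitiveRoot hdexp
  have hζ : IsPrimitiveRoot (χ g₀ : ℂ) d := hχ.map_of_injective 
    (f := Units.coeHom ℂ) Units.val_injective
  have hχ1 : χ ≠ 1 := by
    rintro rfl
    exact hζ.ne_one (by omega) (by simp)
  have hlam := h.2.2.1
  have hsedf := h.sum_sub_mul_conj hχ1
  have hmem (j : Fin m) : ∑ g ∈ D j, (χ g : ℂ) ∈ Algebra.adjoin ℤ {(χ g₀ : ℂ)} := by
    refine sum_mem fun x _ => ?_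
    have : NeZero d := ⟨by omega⟩
    obtain ⟨n, -, hx⟩ := hζ.eq_pow_of_pow_eq_one (ξ := (χ x : ℂ)) 
      (by rw [← Units.val_pow_eq_pow_val, hpow, Units.val_one])
    rw [← hx]
    exact pow_mem (Algebra.self_mem_adjoin_singleton ℤ _) n
  have hconj : (χ g₀ : ℂ) ^ (d - 1) = conj (χ g₀ : ℂ) := by
    rw [← Complex.inv_eq_conj (hζ.norm'_eq_one (by omega))]
    apply eq_inv_of_mul_eq_one_left
    rw [← pow_succ, Nat.sub_add_cancel (by omega), hζ.pow_eq_one]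
  have hne (j : Fin m) : ∑ g ∈ D j, (χ g : ℂ) ≠ 0 := by
    intro h0
    have := hsedf j
    rw [h0] at this
    simp at this
    omega
  obtain ⟨i, j, p, q, hp, hq, hpq⟩ := exists_mul_conj_eq_rat (by simpa using hm) hlam _ hsedf
  obtain ⟨a, ha⟩ := exists_int_eq_of_mem_adjoin (by omega) hζ
    (mul_mem (hmem i) (conj_mem_adjoin_singleton hconj (hmem i))) hp
  obtain ⟨b, hb⟩ := exists_int_eq_of_mem_adjoin (by omega) hζ
    (mul_mem (hmem j) (conj_mem_adjoin_singleton hconj (hmem j))) hq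
  have hab : a * b = (lam : ℤ) ^ 2 := by
    have hpa : p = a := by exact_mod_cast hp.symm.trans ha
    have hqb : q = b := by exact_mod_cast hq.symm.trans hb
    rw [hpa, hqb] at hpq
    exact_mod_cast hpq
  obtain ⟨c₁, c₂, rfl, ⟨u, hu, hxu⟩, w, hw, hyw⟩ := exists_mul_eq_of_selfConjugate hd hζ lam' lam
    _ _ a b hlam hdvd hsc hgcd (hmem i) (hmem j) ha hb hab
  have hpos : 0 < c₁ * c₂ := Nat.pos_of_dvd_of_pos hdvd hlam
  rcases le_total c₁ c₂ with hle | hle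
  · exact ⟨c₂, Nat.pos_of_mul_pos_left hpos, dvd_mul_left _ _, by nlinarith,
      le_of_sum_character_eq_mul (by omega) hζ hpow _ (hne j) hw hyw⟩
  · exact ⟨c₁, Nat.pos_of_mul_pos_right hpos, dvd_mul_right _ _, by nlinarith,
      le_of_sum_character_eq_mul (by omega) hζ hpow _ (hne i) hu hxu⟩
end

section
/- Let p_1, p_2 be two distinct primes, let δ ∈ {0,1}, and let m, a, b, c be positive integers with m > 2. Let q_1,...,q_t be t distinct primes each dividing (m−1)·p_1^{2a+δ}·p_2^{2c} + 1. If p_1 is self-conjugate modulo q_1···q_t and q_1···q_t > 2^{t−1}·((m−1)·p_1^{2a−b}·p_2^{2c} + p_1^{−b}) (as real numbers), then there does not exist an ((m−1)·p_1^{2a+δ}·p_2^{2c}+1, m, p_1^{a+b+δ}·p_2^c, p_1^{2b+δ})-SEDF in any finite abelian group. -/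
/-- Iterated differences of `f` along the shifts in `l`. -/
def shiftDiff {A : Type*} [AddCommGroup A] (l : List A) (f : A → ℤ) : A → ℤ :=
  l.foldr (fun s g x => g x - g (x - s)) f

section shiftDiff

variable {A : Type*} [AddCommGroup A]

theorem shiftDiff_cons (s : A) (l : List A) (f : A → ℤ) (x : A) :
    shiftDiff (s :: l) f x = shiftDiff l f x - shiftDiff l f (x - s) := rfl

theorem shiftDiff_sub_mul (l : List A) (f e : A → ℤ) (n : ℤ) (x : A) :
    shiftDiff l (fun y => f y - n * e y) x = shiftDiff l f x - n * shiftDiff l e x := by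
  induction l generalizing x with
  | nil => rfl
  | cons s l ih => simp only [shiftDiff_cons, ih]; ring

theorem abs_shiftDiff_le {f : A → ℤ} {C : ℤ} (h0 : ∀ x, 0 ≤ f x) (hC : ∀ x, f x ≤ C)
    (s : A) (l : List A) (x : A) : |shiftDiff (s :: l) f x| ≤ 2 ^ l.length * C := by
  induction l generalizing s x with
  | nil =>
    have h1 := h0 x
    have h2 := h0 (x - s)
    have h3 := hC x
    have h4 := hC (x - s)
    simp only [shiftDiff, List.foldr, List.length_nil, pow_zero, one_mul]
    rw [abs_le]
    constructor <;> linarith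
  | cons s' l ih =>
    rw [shiftDiff_cons]
    have h1 := abs_le.1 (ih s' x)
    have h2 := abs_le.1 (ih s' (x - s))
    rw [List.length_cons, pow_succ, abs_le]
    constructor <;> linarith [h1.1, h1.2, h2.1, h2.2]

theorem sum_shiftDiff_mul [Fintype A] (l : List A) (f : A → ℤ) (ψ : AddChar A ℂ) :
    ∑ x, (shiftDiff l f x : ℂ) * ψ x = (l.map fun s => 1 - ψ s).prod * ∑ x, (f x : ℂ) * ψ x := by
  induction l with
  | nil => simp [shiftDiff]
  | cons s l ih =>
    have h : ∑ x, (shiftDiff l f (x - s) : ℂ) * ψ x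
        = ψ s * ∑ x, (shiftDiff l f x : ℂ) * ψ x := by
      rw [← Equiv.sum_comp (Equiv.addRight s), Finset.mul_sum]
      refine Finset.sum_congr rfl fun x _ => ?_
      simp only [Equiv.coe_addRight, add_sub_cancel_right, AddChar.map_add_eq_mul]
      ring
    simp only [shiftDiff_cons, Int.cast_sub, sub_mul, Finset.sum_sub_distrib, h, List.map_cons,
      List.prod_cons]
    rw [ih]
    ring

end shiftDiff

section ZMod

variable {w : ℕ} [NeZero w]

theorem ZMod.stdAddChar_eq_pow (i : ZMod w) :
    (ZMod.stdAddChar i : ℂ) = ZMod.stdAddChar (1 : ZMod w) ^ i.val := by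
  rw [← AddChar.map_nsmul_eq_pow]
  simp

theorem ZMod.isPrimitiveRoot_stdAddChar_one :
    IsPrimitiveRoot (ZMod.stdAddChar (1 : ZMod w) : ℂ) w := by
  have h := ZMod.stdAddChar_coe (N := w) 1
  simp only [Int.cast_one, mul_one] at h
  rw [h]
  exact Complex.isPrimitiveRoot_exp w (NeZero.ne w)

/-- Galois conjugation of a vanishing integral combination of `w`-th roots of unity. -/
theorem ZMod.sum_stdAddChar_mul_unit_eq_zero {h : ZMod w → ℤ}
    (h0 : ∑ x, (h x : ℂ) * ZMod.stdAddChar x = 0) {k : ZMod w} (hk : IsUnit k) :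
    ∑ x, (h x : ℂ) * ZMod.stdAddChar (x * k) = 0 := by
  classical
  set ζ : ℂ := ZMod.stdAddChar (1 : ZMod w) with hζ
  have hprim : IsPrimitiveRoot ζ w := ZMod.isPrimitiveRoot_stdAddChar_one
  have hint : IsIntegral ℤ ζ := hprim.isIntegral (Nat.pos_of_ne_zero (NeZero.ne w))
  let P : Polynomial ℤ := ∑ x, Polynomial.C (h x) * Polynomial.X ^ x.val
  have hP : ∀ z : ℂ, Polynomial.aeval z P = ∑ x, (h x : ℂ) * z ^ x.val := fun z => by
    simp [P]
  have hcop : k.val.Coprime w := by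
    rw [← ZMod.isUnit_iff_coprime]
    simpa using hk
  have h1 : Polynomial.aeval ζ P = 0 := by
    rw [hP, ← h0]
    exact Finset.sum_congr rfl fun x _ => by rw [ZMod.stdAddChar_eq_pow x]
  have hdvd := minpoly.isIntegrallyClosed_dvd hint h1
  rw [hprim.minpoly_eq_pow_coprime hcop] at hdvd
  have h2 : Polynomial.aeval (ζ ^ k.val) P = 0 := by
    obtain ⟨Q, hQ⟩ := hdvd
    rw [hQ, map_mul, minpoly.aeval, zero_mul]
  rw [hP] at h2
  rw [← h2]
  refine Finset.sum_congr rfl fun x _ => ?_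
  rw [← ZMod.stdAddChar_eq_pow k, ← AddChar.map_nsmul_eq_pow]
  simp

/-- Turyn's bound, for a list of shifts killing every non-unit of `ZMod w`. -/
theorem ZMod.le_of_sum_stdAddChar_eq_mul {f e : ZMod w → ℤ} {C n : ℤ} (hn : 0 < n)
    (hf0 : ∀ x, 0 ≤ f x) (hfC : ∀ x, f x ≤ C)
    (s : ZMod w) (l : List (ZMod w)) (hl0 : ∀ a ∈ s :: l, a ≠ 0)
    (hl : ∀ k : ZMod w, ¬ IsUnit k → ∃ a ∈ s :: l, a * k = 0)
    (hfe : ∑ x, (f x : ℂ) * ZMod.stdAddChar x = n * ∑ x, (e x : ℂ) * ZMod.stdAddChar x)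
    (hne : ∑ x, (f x : ℂ) * ZMod.stdAddChar x ≠ 0) : n ≤ 2 ^ l.length * C := by
  set h : ZMod w → ℤ := fun y => f y - n * e y with hh
  have h0 : ∑ x, (h x : ℂ) * ZMod.stdAddChar x = 0 := by
    simp only [hh, Int.cast_sub, Int.cast_mul, sub_mul, Finset.sum_sub_distrib, hfe,
      Finset.mul_sum, mul_assoc, sub_self]
  have key : ∀ k : ZMod w,
      ∑ x, (shiftDiff (s :: l) h x : ℂ) * ZMod.stdAddChar (x * k) = 0 := fun k => by
    have hs := sum_shiftDiff_mul (s :: l) h (AddChar.mulShift ZMod.stdAddChar k)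
    simp only [AddChar.mulShift_apply] at hs
    simp only [mul_comm _ k]
    rw [hs]
    by_cases hk : IsUnit k
    · have := ZMod.sum_stdAddChar_mul_unit_eq_zero h0 hk
      simp only [mul_comm _ k] at this
      rw [this, mul_zero]
    · obtain ⟨a, ha, hak⟩ := hl k hk
      rw [List.prod_eq_zero, zero_mul]
      exact List.mem_map.2 ⟨a, ha, by rw [mul_comm k a, hak]; simp⟩
  have hzero : (fun x => (shiftDiff (s :: l) h x : ℂ)) = 0 := by
    apply (ZMod.dft (N := w) (E := ℂ)).injective
    rw [map_zero]
    funext k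
    rw [ZMod.dft_apply, Pi.zero_apply, ← key (-k)]
    refine Finset.sum_congr rfl fun x _ => ?_
    rw [smul_eq_mul, mul_comm, mul_neg]
  have hdvd : ∀ x, n ∣ shiftDiff (s :: l) f x := fun x => by
    have h1 : shiftDiff (s :: l) h x = 0 := by
      have h2 : (shiftDiff (s :: l) h x : ℂ) = 0 := congrFun hzero x
      exact_mod_cast h2
    rw [hh, shiftDiff_sub_mul, sub_eq_zero] at h1
    exact ⟨_, h1⟩
  have hex : ∃ x, shiftDiff (s :: l) f x ≠ 0 := by
    by_contra! hall
    have hs := sum_shiftDiff_mul (s :: l) f ZMod.stdAddChar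
    simp only [hall, Int.cast_zero, zero_mul, Finset.sum_const_zero] at hs
    rcases mul_eq_zero.1 hs.symm with h1 | h1
    · obtain ⟨a, ha, ha1⟩ := List.mem_map.1 (List.prod_eq_zero_iff.1 h1)
      apply hl0 a ha
      apply ZMod.injective_stdAddChar
      rw [AddChar.map_zero_eq_one]
      exact (sub_eq_zero.1 ha1).symm
    · exact hne h1
  obtain ⟨x, hx⟩ := hex
  calc n = |n| := (abs_of_pos hn).symm
    _ ≤ |shiftDiff (s :: l) f x| :=
      Int.le_of_dvd (abs_pos.2 hx) ((abs_dvd_abs _ _).2 (hdvd x))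
    _ ≤ _ := abs_shiftDiff_le hf0 hfC s l x

end ZMod

section cyclotomicRing

/-- The ring of integers `ℤ[ζ_w]` inside `ℂ`. -/
noncomputable def cyclotomicOrder (w : ℕ) [NeZero w] : Subalgebra ℤ ℂ :=
  Algebra.adjoin ℤ {(ZMod.stdAddChar (1 : ZMod w) : ℂ)}

variable {w : ℕ} [NeZero w]

theorem stdAddChar_mem_cyclotomicOrder (i : ZMod w) :
    (ZMod.stdAddChar i : ℂ) ∈ cyclotomicOrder w := by
  rw [ZMod.stdAddChar_eq_pow]
  exact pow_mem (Algebra.self_mem_adjoin_singleton _ _) _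

theorem isIntegral_of_mem_cyclotomicOrder {x : ℂ} (hx : x ∈ cyclotomicOrder w) :
    IsIntegral ℤ x := by
  induction hx using Algebra.adjoin_induction with
  | mem x hx =>
    rw [Set.mem_singleton_iff.1 hx]
    exact ZMod.isPrimitiveRoot_stdAddChar_one.isIntegral (Nat.pos_of_ne_zero (NeZero.ne w))
  | algebraMap r => exact isIntegral_algebraMap
  | add x y _ _ hx hy => exact hx.add hy
  | mul x y _ _ hx hy => exact hx.mul hy

theorem conj_mem_cyclotomicOrder {x : ℂ} (hx : x ∈ cyclotomicOrder w) :
    (starRingEnd ℂ) x ∈ cyclotomicOrder w := by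
  induction hx using Algebra.adjoin_induction with
  | mem x hx =>
    rw [Set.mem_singleton_iff.1 hx, ← AddChar.map_neg_eq_conj]
    exact stdAddChar_mem_cyclotomicOrder _
  | algebraMap r =>
    simp
  | add x y _ _ hx hy => rw [map_add]; exact add_mem hx hy
  | mul x y _ _ hx hy => rw [map_mul]; exact mul_mem hx hy

theorem exists_eq_sum_of_mem_cyclotomicOrder {x : ℂ} (hx : x ∈ cyclotomicOrder w) :
    ∃ e : ZMod w → ℤ, x = ∑ i, (e i : ℂ) * ZMod.stdAddChar i := by
  rw [cyclotomicOrder, Algebra.adjoin_singleton_eq_range_aeval] at hx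
  obtain ⟨P, rfl⟩ := hx
  induction P using Polynomial.induction_on' with
  | add P Q hP hQ =>
    obtain ⟨e, he⟩ := hP
    obtain ⟨e', he'⟩ := hQ
    refine ⟨e + e', ?_⟩
    simp only [AlgHom.toRingHom_eq_coe, RingHom.coe_coe, map_add] at he he' ⊢
    rw [he, he', ← Finset.sum_add_distrib]
    refine Finset.sum_congr rfl fun i _ => ?_
    simp [add_mul]
  | monomial n c =>
    refine ⟨Pi.single (n : ZMod w) c, ?_⟩
    rw [Finset.sum_eq_single (n : ZMod w)]
    · simp [Polynomial.aeval_monomial, ← AddChar.map_nsmul_eq_pow]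
    · intro i _ hi
      simp [Pi.single_eq_of_ne hi]
    · simp

theorem exists_pow_eq_conj_add {p r : ℕ} (hp : p.Prime) (hr : (p : ZMod w) ^ r = -1)
    {x : ℂ} (hx : x ∈ cyclotomicOrder w) :
    ∃ z ∈ cyclotomicOrder w, x ^ p ^ r = (starRingEnd ℂ) x + p * z := by
  have hadd : ∀ x ∈ cyclotomicOrder w, ∀ y ∈ cyclotomicOrder w, ∃ z ∈ cyclotomicOrder w,
      (x + y) ^ p ^ r = x ^ p ^ r + y ^ p ^ r + p * z := fun x hx y hy => by
    obtain ⟨z, hz⟩ := exists_add_pow_prime_pow_eq hp (⟨x, hx⟩ : cyclotomicOrder w) ⟨y, hy⟩ r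
    refine ⟨x * y * z, mul_mem (mul_mem hx hy) z.2, ?_⟩
    have := congrArg Subtype.val hz
    push_cast at this
    rw [this]
    ring
  have hint : ∀ c : ℤ, ∃ z ∈ cyclotomicOrder w, (c : ℂ) ^ p ^ r = c + p * z := fun c => by
    have := Fact.mk hp
    have h : (p : ℤ) ∣ c ^ p ^ r - c := by
      rw [← ZMod.intCast_zmod_eq_zero_iff_dvd]
      push_cast
      rw [ZMod.pow_card_pow, sub_self]
    obtain ⟨d, hd⟩ := h
    refine ⟨d, (cyclotomicOrder w).algebraMap_mem d, ?_⟩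
    have : (c : ℂ) ^ p ^ r - c = p * d := by exact_mod_cast hd
    rw [← this]
    ring
  induction hx using Algebra.adjoin_induction with
  | mem x hx =>
    refine ⟨0, zero_mem _, ?_⟩
    rw [Set.mem_singleton_iff.1 hx, ← AddChar.map_neg_eq_conj, ← AddChar.map_nsmul_eq_pow]
    simp [hr]
  | algebraMap c => simpa using hint c
  | add x y hx hy ihx ihy =>
    obtain ⟨z, hz, h⟩ := hadd x hx y hy
    obtain ⟨z₁, hz₁, h₁⟩ := ihx
    obtain ⟨z₂, hz₂, h₂⟩ := ihy
    refine ⟨z + z₁ + z₂, add_mem (add_mem hz hz₁) hz₂, ?_⟩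
    rw [h, h₁, h₂, map_add]
    ring
  | mul x y hx hy ihx ihy =>
    obtain ⟨z₁, hz₁, h₁⟩ := ihx
    obtain ⟨z₂, hz₂, h₂⟩ := ihy
    refine ⟨(starRingEnd ℂ) x * z₂ + (starRingEnd ℂ) y * z₁ + p * z₁ * z₂, ?_, ?_⟩
    · exact add_mem (add_mem (mul_mem (conj_mem_cyclotomicOrder hx) hz₂)
        (mul_mem (conj_mem_cyclotomicOrder hy) hz₁))
        (mul_mem (mul_mem (natCast_mem _ p) hz₁) hz₂)
    · rw [mul_pow, h₁, h₂, map_mul]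
      ring

/-- `ℤ[ζ_w]/p` is reduced, and conjugation is a power of Frobenius on it. -/
theorem exists_eq_mul_of_mul_conj_eq_mul {p r : ℕ} (hp : p.Prime) (hr0 : r ≠ 0)
    (hr : (p : ZMod w) ^ r = -1) {x z : ℂ} (hx : x ∈ cyclotomicOrder w)
    (hz : z ∈ cyclotomicOrder w) (h : x * (starRingEnd ℂ) x = p * z) :
    ∃ u ∈ cyclotomicOrder w, x = p * u := by
  obtain ⟨z₁, hz₁, h₁⟩ := exists_pow_eq_conj_add hp hr hx
  obtain ⟨z₂, hz₂, h₂⟩ := exists_pow_eq_conj_add hp hr (pow_mem hx (p ^ r))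
  have h3 : (starRingEnd ℂ) (x ^ p ^ r) = x + p * (starRingEnd ℂ) z₁ := by
    rw [h₁]; simp
  have hle : 1 ≤ p ^ r - 1 := by
    have := Nat.le_self_pow hr0 p
    have := hp.two_le
    omega
  obtain ⟨M, hM⟩ : ∃ M, p ^ r = M + 2 := ⟨p ^ r - 2, by omega⟩
  have hcm := conj_mem_cyclotomicOrder hz₁
  have h4 : x * x ^ p ^ r = p * (z + x * z₁) := by
    rw [h₁, mul_add, h]; ring
  have h5 : (x ^ p ^ r) ^ p ^ r
      = p * ((z + x * z₁) * (x ^ (M + 1) * (x ^ p ^ r) ^ M)) := by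
    calc (x ^ p ^ r) ^ p ^ r = (x * x ^ p ^ r) * (x ^ (M + 1) * (x ^ p ^ r) ^ M) := by
          rw [hM]; ring
      _ = _ := by rw [h4]; ring
  refine ⟨(z + x * z₁) * (x ^ (M + 1) * (x ^ p ^ r) ^ M) - (starRingEnd ℂ) z₁ - z₂, ?_, ?_⟩
  · exact sub_mem (sub_mem (mul_mem (add_mem hz (mul_mem hx hz₁))
      (mul_mem (pow_mem hx _) (pow_mem (pow_mem hx _) _))) hcm) hz₂
  · have h6 := h5.symm.trans h₂
    rw [h3] at h6
    linear_combination -h6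

theorem exists_eq_pow_mul_of_mul_conj_eq_pow_mul {p r : ℕ} (hp : p.Prime) (hr0 : r ≠ 0)
    (hr : (p : ZMod w) ^ r = -1) (k : ℕ) {x z : ℂ} (hx : x ∈ cyclotomicOrder w)
    (hz : z ∈ cyclotomicOrder w) (h : x * (starRingEnd ℂ) x = p ^ (2 * k + 1) * z) :
    ∃ u ∈ cyclotomicOrder w, x = p ^ (k + 1) * u := by
  have hp0 : (p : ℂ) ≠ 0 := by exact_mod_cast hp.ne_zero
  induction k generalizing x with
  | zero =>
    obtain ⟨u, hu, h1⟩ := exists_eq_mul_of_mul_conj_eq_mul hp hr0 hr hx hz (by simpa using h)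
    exact ⟨u, hu, by simpa using h1⟩
  | succ k ih =>
    obtain ⟨y, hy, rfl⟩ := exists_eq_mul_of_mul_conj_eq_mul hp hr0 hr hx
      (mul_mem (pow_mem (natCast_mem _ p) (2 * k + 2)) hz) (by rw [h]; ring)
    obtain ⟨u, hu, h1⟩ := ih hy (by
      apply mul_left_cancel₀ (pow_ne_zero 2 hp0)
      simp only [map_mul, map_natCast] at h
      linear_combination h)
    exact ⟨u, hu, by rw [h1]; ring⟩

end cyclotomicRing

section blocks

open Complex in
/-- Some block has a character value of rational squared modulus at least `lam`. -/
theorem exists_le_normSq_of_conj_mul_eq {m : ℕ} (hm : 2 < m) {lam : ℝ} (hlam : 0 < lam)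
    {x : Fin m → ℂ} (h : ∀ j, (starRingEnd ℂ) (x j) * (∑ l, x l - x j) = -lam) :
    ∃ j, lam ≤ normSq (x j) ∧ ∃ u v : ℤ, u ≠ 0 ∧ u * normSq (x j) = v * lam := by
  classical
  set y := ∑ l, x l with hy
  have h1 : ∀ j, (starRingEnd ℂ) (x j) * y = ((normSq (x j) - lam : ℝ) : ℂ) := fun j => by
    have h2 := h j
    push_cast
    rw [normSq_eq_conj_mul_self]
    linear_combination h2
  have hsum : normSq y = ∑ j, (normSq (x j) - lam) := by
    have h2 : (normSq y : ℂ) = ((∑ j, (normSq (x j) - lam) : ℝ) : ℂ) := by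
      rw [normSq_eq_conj_mul_self, ofReal_sum, ← Finset.sum_congr rfl fun j _ => h1 j,
        ← Finset.sum_mul, ← map_sum]
    exact_mod_cast h2
  have hsq : ∀ j, normSq (x j) * normSq y = (normSq (x j) - lam) ^ 2 := fun j => by
    have h2 := congrArg normSq (h1 j)
    rw [map_mul, normSq_conj, normSq_ofReal] at h2
    rw [h2, sq]
  obtain ⟨j, hj⟩ : ∃ j, lam ≤ normSq (x j) := by
    by_contra! hall
    have h2 : ∑ j, (normSq (x j) - lam) < 0 :=
      Finset.sum_neg (fun j _ => sub_neg.2 (hall j)) ⟨⟨0, by omega⟩, Finset.mem_univ _⟩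
    linarith [normSq_nonneg y]
  refine ⟨j, hj, ?_⟩
  set A := normSq (x j) with hA
  have hA0 : 0 < A := lt_of_lt_of_le hlam hj
  have hdich : ∀ l, normSq (x l) ≠ A → normSq (x l) = lam ^ 2 / A := fun l hl => by
    have h2 := hsq l
    have h3 := hsq j
    have h4 : (normSq (x l) - A) * (A * normSq (x l) - lam ^ 2) = 0 := by
      linear_combination normSq (x l) * h3 - A * h2
    rcases mul_eq_zero.1 h4 with h5 | h5
    · exact absurd (sub_eq_zero.1 h5) hl
    · rw [eq_div_iff hA0.ne']
      linarith
  set P := (Finset.univ.filter fun l => normSq (x l) = A).card with hP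
  have hcards : P + (Finset.univ.filter fun l => ¬ normSq (x l) = A).card = m := by
    rw [hP, Finset.card_filter_add_card_filter_not, Finset.card_univ, Fintype.card_fin]
  have hX : normSq y = P * A + (m - P) * (lam ^ 2 / A) - m * lam := by
    rw [hsum, Finset.sum_sub_distrib, Finset.sum_const, Finset.card_univ, Fintype.card_fin,
      nsmul_eq_mul, ← Finset.sum_filter_add_sum_filter_not Finset.univ
        (fun l => normSq (x l) = A), Finset.sum_congr rfl fun l hl => (Finset.mem_filter.1 hl).2,
      Finset.sum_congr (s₁ := Finset.univ.filter fun l => ¬ normSq (x l) = A) rfl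
        fun l hl => hdich l (Finset.mem_filter.1 hl).2]
    simp only [Finset.sum_const, nsmul_eq_mul]
    have hcards' : (P : ℝ) + (Finset.univ.filter fun l => ¬ normSq (x l) = A).card = m := by
      exact_mod_cast hcards
    rw [← hP]
    linear_combination (lam ^ 2 / A) * hcards'
  have hfac : (A - lam) * ((P - 1) * A - (m - P - 1) * lam) = 0 := by
    have h2 := hsq j
    rw [hX] at h2
    have h3 : A * (lam ^ 2 / A) = lam ^ 2 := mul_div_cancel₀ _ hA0.ne'
    linear_combination h2 - (m - P) * h3
  rcases mul_eq_zero.1 hfac with h2 | h2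
  · exact ⟨1, 1, one_ne_zero, by push_cast; linarith⟩
  · refine ⟨P - 1, m - P - 1, fun h3 => ?_, by push_cast; linarith⟩
    have h4 : (P : ℝ) = 1 := by exact_mod_cast sub_eq_zero.1 h3
    rw [h4] at h2
    have h5 : (2 : ℝ) < m := by exact_mod_cast hm
    nlinarith

/-- A rational element of `ℤ[ζ_w]` is an integer. -/
theorem exists_int_eq_of_mem_cyclotomicOrder {w : ℕ} [NeZero w] {A : ℝ}
    (hA : (A : ℂ) ∈ cyclotomicOrder w) {u v : ℤ} (hu : u ≠ 0) (h : u * A = v) :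
    ∃ c : ℤ, A = c := by
  have hu' : (u : ℝ) ≠ 0 := by exact_mod_cast hu
  have h1 : algebraMap ℚ ℂ (v / u) = A := by
    have : A = v / u := by rw [eq_div_iff hu', ← h]; ring
    rw [this]; simp
  have h2 := isIntegral_of_mem_cyclotomicOrder hA
  rw [← h1, isIntegral_algebraMap_iff (algebraMap ℚ ℂ).injective,
    IsIntegrallyClosed.isIntegral_iff] at h2
  obtain ⟨c, hc⟩ := h2
  refine ⟨c, ?_⟩
  rw [← hc] at h1
  have h3 : (c : ℂ) = A := by simpa using h1
  exact_mod_cast h3.symm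

open Complex in
/-- If the block character values satisfy the SEDF equations with `lam` a power of a prime `p`,
then the squared modulus of one of them is an integer multiple of `lam`. -/
theorem exists_mul_conj_eq_pow_mul {w : ℕ} [NeZero w] {m : ℕ} (hm : 2 < m) {p n : ℕ}
    (hp : p.Prime) {x : Fin m → ℂ} (hx : ∀ j, x j ∈ cyclotomicOrder w)
    (h : ∀ j, (starRingEnd ℂ) (x j) * (∑ l, x l - x j) = -((p ^ n : ℕ) : ℝ)) :
    ∃ j, ∃ z ∈ cyclotomicOrder w, x j * (starRingEnd ℂ) (x j) = p ^ n * z := by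
  set L : ℕ := p ^ n with hL
  have hL0 : 0 < L := pow_pos hp.pos n
  have hL0' : (0 : ℝ) < L := by exact_mod_cast hL0
  obtain ⟨j, hj, u, v, hu, huv⟩ := exists_le_normSq_of_conj_mul_eq hm hL0' h
  refine ⟨j, ?_⟩
  have hmem : ∀ z ∈ cyclotomicOrder w, ((normSq z : ℝ) : ℂ) ∈ cyclotomicOrder w := fun z hz => by
    rw [normSq_eq_conj_mul_self]
    exact mul_mem (conj_mem_cyclotomicOrder hz) hz
  have hA0 : 0 < normSq (x j) := lt_of_lt_of_le hL0' hj
  have hprod : normSq (x j) * normSq (∑ l, x l - x j) = (L : ℝ) ^ 2 := by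
    have h1 := congrArg normSq (h j)
    rw [map_mul, normSq_conj, normSq_neg, normSq_ofReal] at h1
    rw [h1, sq]
  have hv : v ≠ 0 := by
    rintro rfl
    simp only [Int.cast_zero, zero_mul, mul_eq_zero, Int.cast_eq_zero] at huv
    exact huv.elim hu hA0.ne'
  obtain ⟨c, hc⟩ := exists_int_eq_of_mem_cyclotomicOrder (hmem _ (hx j)) (u := u) (v := v * L) hu
    (by push_cast; exact huv)
  obtain ⟨d, hd⟩ := exists_int_eq_of_mem_cyclotomicOrder
    (hmem _ (sub_mem (sum_mem fun l _ => hx l) (hx j))) (u := v) (v := u * L) hv (by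
      apply mul_left_cancel₀ (mul_ne_zero hA0.ne' hL0'.ne')
      push_cast
      linear_combination (v * L : ℝ) * hprod - (L : ℝ) ^ 2 * huv)
  rw [hc, hd] at hprod
  rw [hc] at hj hA0
  have hcd : c * d = (L : ℤ) ^ 2 := by exact_mod_cast hprod
  have hLc : (L : ℤ) ≤ c := by exact_mod_cast hj
  lift c to ℕ using by omega
  have hdvd : c ∣ p ^ (n * 2) := by
    rw [pow_mul, ← hL]
    have : (c : ℤ) ∣ (L : ℤ) ^ 2 := ⟨d, hcd.symm⟩
    exact_mod_cast this
  obtain ⟨i, -, rfl⟩ := (Nat.dvd_prime_pow hp).1 hdvd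
  have hni : n ≤ i := (Nat.pow_le_pow_iff_right hp.one_lt).1 (by exact_mod_cast hLc)
  refine ⟨p ^ (i - n), pow_mem (natCast_mem _ p) _, ?_⟩
  rw [mul_conj, hc, ← pow_add, Nat.add_sub_cancel' hni]
  push_cast
  rfl

end blocks

section group

variable {G : Type*} [CommGroup G]

theorem exists_apply_eq_stdAddChar {w : ℕ} [NeZero w] {χ : G →* ℂˣ} (hχ : orderOf χ = w) (g : G) :
    ∃ i : ZMod w, (χ g : ℂ) = ZMod.stdAddChar i := by
  have h : (χ g : ℂ) ^ w = 1 := by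
    rw [← Units.val_pow_eq_pow_val, ← MonoidHom.pow_apply, ← hχ, pow_orderOf_eq_one]
    simp
  obtain ⟨i, -, hi⟩ := (ZMod.isPrimitiveRoot_stdAddChar_one (w := w)).eq_pow_of_pow_eq_one h
  exact ⟨i, by rw [← hi, ← AddChar.map_nsmul_eq_pow]; simp⟩

open Classical in
theorem sum_character_eq_sum_stdAddChar {w : ℕ} [NeZero w] {χ : G →* ℂˣ} (hχ : orderOf χ = w)
    (S : Finset G) : ∑ g ∈ S, (χ g : ℂ)
      = ∑ i : ZMod w, (((S.filter fun g => (χ g : ℂ) = ZMod.stdAddChar i).card : ℤ) : ℂ)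
        * ZMod.stdAddChar i := by
  choose φ hφ using exists_apply_eq_stdAddChar hχ
  rw [← Finset.sum_fiberwise _ φ]
  refine Finset.sum_congr rfl fun i _ => ?_
  have h1 : S.filter (fun g => (χ g : ℂ) = ZMod.stdAddChar i) = S.filter (fun g => φ g = i) :=
    Finset.filter_congr fun g _ => by rw [hφ, ZMod.injective_stdAddChar.eq_iff]
  rw [h1, Finset.sum_congr rfl fun g hg => by rw [hφ, (Finset.mem_filter.1 hg).2],
    Finset.sum_const, nsmul_eq_mul, Int.cast_natCast]

variable [Fintype G]

/-- The character equations of an SEDF. -/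
theorem IsSEDF.conj_sum_mul_eq [DecidableEq G] {m k lam : ℕ} {D : Fin m → Finset G}
    (hD : IsSEDF D k lam) {χ : G →* ℂˣ} (hχ : χ ≠ 1) (j : Fin m) :
    (starRingEnd ℂ) (∑ g ∈ D j, (χ g : ℂ)) * (∑ l, ∑ g ∈ D l, (χ g : ℂ) - ∑ g ∈ D j, (χ g : ℂ))
      = -(lam : ℝ) := by
  obtain ⟨-, -, -, -, -, hcount⟩ := hD
  have hconj : ∀ g, (starRingEnd ℂ) (χ g : ℂ) = χ g⁻¹ := fun g => by
    have hn : ‖(χ g : ℂ)‖ = 1 := by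
      apply Complex.norm_eq_one_of_pow_eq_one (n := Fintype.card G) _ Fintype.card_ne_zero
      rw [← Units.val_pow_eq_pow_val, ← map_pow, pow_card_eq_one, map_one, Units.val_one]
    rw [map_inv, Units.val_inv_eq_inv_val, Complex.inv_eq_conj hn]
  have hsum : ∑ g, (χ g : ℂ) = 0 := by
    refine sum_hom_units_eq_zero ((Units.coeHom ℂ).comp χ) fun h => hχ ?_
    ext g
    simpa using DFunLike.congr_fun h g
  have herase : ∑ l, ∑ g ∈ D l, (χ g : ℂ) - ∑ g ∈ D j, (χ g : ℂ)
      = ∑ l ∈ Finset.univ.filter (fun l => l ≠ j), ∑ g ∈ D l, (χ g : ℂ) := by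
    rw [Finset.filter_ne', ← Finset.add_sum_erase _ _ (Finset.mem_univ j), add_sub_cancel_left]
  have hpair : ∀ l, (starRingEnd ℂ) (∑ g ∈ D j, (χ g : ℂ)) * ∑ g ∈ D l, (χ g : ℂ)
      = ∑ g, (((D l ×ˢ D j).filter (fun x => x.1 * x.2⁻¹ = g)).card : ℂ) * χ g := fun l => by
    have h1 : ∑ x ∈ D l ×ˢ D j, (χ (x.1 * x.2⁻¹) : ℂ)
        = ∑ g, (((D l ×ˢ D j).filter (fun x => x.1 * x.2⁻¹ = g)).card : ℂ) * χ g := by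
      rw [← Finset.sum_fiberwise _ (fun x : G × G => x.1 * x.2⁻¹)]
      refine Finset.sum_congr rfl fun g _ => ?_
      rw [Finset.sum_congr rfl fun x hx => by rw [(Finset.mem_filter.1 hx).2]]
      rw [Finset.sum_const, nsmul_eq_mul]
    rw [← h1, Finset.sum_product, map_sum, mul_comm, Finset.sum_mul_sum]
    refine Finset.sum_congr rfl fun a _ => Finset.sum_congr rfl fun b _ => ?_
    rw [hconj, map_mul, Units.val_mul]
  rw [herase, Finset.mul_sum, Finset.sum_congr rfl fun l _ => hpair l, Finset.sum_comm]
  have h2 : ∀ g : G, ∑ l ∈ Finset.univ.filter (fun l => l ≠ j),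
      (((D l ×ˢ D j).filter (fun x => x.1 * x.2⁻¹ = g)).card : ℂ) * χ g
      = lam * χ g - if g = 1 then (lam : ℂ) else 0 := fun g => by
    have h3 := hcount j g
    rw [← Finset.sum_mul, ← Nat.cast_sum, h3]
    split_ifs with hg <;> simp [hg]
  rw [Finset.sum_congr rfl fun g _ => h2 g, Finset.sum_sub_distrib, ← Finset.mul_sum, hsum]
  simp

/-- A finite abelian group has a character onto the `w`-th roots of unity, for every `w` dividing
its exponent. -/
theorem exists_character_orderOf_eq {w : ℕ} (hw : w ∣ Monoid.exponent G) :
    ∃ χ : G →* ℂˣ, orderOf χ = w := by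
  obtain ⟨e⟩ := CommGroup.monoidHom_mulEquiv_of_hasEnoughRootsOfUnity G ℂ
  obtain ⟨g, hg⟩ := Monoid.exists_orderOf_eq_exponent (Monoid.ExponentExists.of_finite (G := G))
  rw [← hg] at hw
  have h0 : orderOf g ≠ 0 := (orderOf_pos g).ne'
  obtain ⟨d, hd⟩ := hw
  refine ⟨e.symm (g ^ d), ?_⟩
  rw [MulEquiv.orderOf_eq, orderOf_pow_of_dvd (by rintro rfl; exact h0 (by simpa using hd))
    (Dvd.intro_left _ hd.symm), hd]
  exact Nat.mul_div_cancel _ (Nat.pos_of_ne_zero (by rintro rfl; exact h0 (by simpa using hd)))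

theorem exists_apply_eq_stdAddChar_one {w : ℕ} [NeZero w] {χ : G →* ℂˣ} (hχ : orderOf χ = w) :
    ∃ g, (χ g : ℂ) = ZMod.stdAddChar (1 : ZMod w) := by
  obtain ⟨⟨ξ, g, rfl⟩, hgen⟩ := IsCyclic.exists_generator (α := χ.range)
  have hζ : IsPrimitiveRoot (χ g : ℂ) w := by
    refine ⟨?_, fun n hn => ?_⟩
    · rw [← Units.val_pow_eq_pow_val, ← MonoidHom.pow_apply, ← hχ, pow_orderOf_eq_one]
      simp
    · rw [← hχ]
      refine orderOf_dvd_of_pow_eq_one (MonoidHom.ext fun a => ?_)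
      obtain ⟨i, hi⟩ := Subgroup.mem_zpowers_iff.1 (hgen ⟨χ a, a, rfl⟩)
      have hi' : χ g ^ i = χ a := by simpa using congrArg Subtype.val hi
      have hn' : χ g ^ n = 1 := by ext; simpa using hn
      rw [MonoidHom.pow_apply, ← hi', ← zpow_natCast, ← zpow_mul, mul_comm, zpow_mul,
        zpow_natCast, hn', one_zpow, MonoidHom.one_apply]
  obtain ⟨i, -, hi⟩ := hζ.eq_pow_of_pow_eq_one
    (ZMod.isPrimitiveRoot_stdAddChar_one (w := w)).pow_eq_one
  exact ⟨g ^ i, by rw [map_pow, Units.val_pow_eq_pow_val, hi]⟩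

open Classical in
theorem card_fiber_stdAddChar {w : ℕ} [NeZero w] {χ : G →* ℂˣ} (hχ : orderOf χ = w) (i : ZMod w) :
    w * (Finset.univ.filter fun g => (χ g : ℂ) = ZMod.stdAddChar i).card = Fintype.card G := by
  set f : G →* ℂ := (Units.coeHom ℂ).comp χ with hf
  have hfχ : ∀ g, f g = χ g := fun g => rfl
  obtain ⟨g, hg⟩ := exists_apply_eq_stdAddChar_one hχ
  have hrange : ∀ i : ZMod w, (ZMod.stdAddChar i : ℂ) ∈ Set.range f := fun i =>
    ⟨g ^ i.val, by rw [map_pow, hfχ, hg, ← ZMod.stdAddChar_eq_pow]⟩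
  have h1 : ∑ i' : ZMod w, (Finset.univ.filter fun g => f g = ZMod.stdAddChar i').card
      = Fintype.card G := by
    choose φ hφ using exists_apply_eq_stdAddChar hχ
    rw [← Finset.card_univ, Finset.card_eq_sum_card_fiberwise (f := φ) (t := Finset.univ)
      (fun _ _ => Finset.mem_coe.2 (Finset.mem_univ _))]
    refine Finset.sum_congr rfl fun i _ => congrArg _ (Finset.filter_congr fun g _ => ?_)
    rw [hfχ, hφ, ZMod.injective_stdAddChar.eq_iff]
  rw [← h1, Finset.sum_congr rfl fun i' _ =>
    MonoidHom.card_fiber_eq_of_mem_range f (hrange i') (hrange i)]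
  simp [hfχ]

end group

section primes

variable {t : ℕ} {q : Fin t → ℕ}

theorem prod_primes_dvd_of_injective (hq : ∀ i, (q i).Prime) (hinj : Function.Injective q) {n : ℕ}
    (h : ∀ i, q i ∣ n) : ∏ i, q i ∣ n :=
  Finset.prod_dvd_of_isRelPrime
    (fun i _ j _ hij => Nat.coprime_iff_isRelPrime.1
      ((Nat.coprime_primes (hq i) (hq j)).2 (hinj.ne hij)))
    fun i _ => h i

theorem prod_div_ne_zero (hq : ∀ i, (q i).Prime) (i : Fin t) :
    (((∏ j, q j) / q i : ℕ) : ZMod (∏ j, q j)) ≠ 0 := by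
  have hpos : 0 < ∏ j, q j := Finset.prod_pos fun j _ => (hq j).pos
  rw [Ne, ZMod.natCast_eq_zero_iff]
  have hdvd : q i ∣ ∏ j, q j := Finset.dvd_prod_of_mem q (Finset.mem_univ i)
  exact Nat.not_dvd_of_pos_of_lt (Nat.div_pos (Nat.le_of_dvd hpos hdvd) (hq i).pos)
    (Nat.div_lt_self hpos (hq i).one_lt)

theorem exists_prod_div_mul_eq_zero (hq : ∀ i, (q i).Prime) {k : ZMod (∏ j, q j)}
    (hk : ¬ IsUnit k) : ∃ i, (((∏ j, q j) / q i : ℕ) : ZMod (∏ j, q j)) * k = 0 := by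
  have : NeZero (∏ j, q j) := ⟨Finset.prod_ne_zero_iff.2 fun j _ => (hq j).ne_zero⟩
  obtain ⟨n, rfl⟩ := ZMod.natCast_zmod_surjective k
  rw [ZMod.isUnit_iff_coprime, Nat.Prime.not_coprime_iff_dvd] at hk
  obtain ⟨l, hl, ⟨d, rfl⟩, hlw⟩ := hk
  obtain ⟨i, -, hi⟩ := (hl.prime.dvd_finsetProd_iff _).1 hlw
  rw [Nat.prime_dvd_prime_iff_eq hl (hq i)] at hi
  subst hi
  refine ⟨i, ?_⟩
  rw [← Nat.cast_mul, ← mul_assoc, Nat.div_mul_cancel hlw, Nat.cast_mul, ZMod.natCast_self,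
    zero_mul]

end primes

theorem exists_ne_zero_pow_eq_neg_one {p w r : ℕ} (hw : 0 < w) (hp : p.Coprime w)
    (hr : (p : ZMod w) ^ r = -1) : ∃ s, s ≠ 0 ∧ (p : ZMod w) ^ s = -1 := by
  refine ⟨r + w.totient, by have := Nat.totient_pos.2 hw; omega, ?_⟩
  have h := congrArg Units.val (ZMod.pow_totient (ZMod.unitOfCoprime p hp))
  rw [Units.val_pow_eq_pow_val, ZMod.coe_unitOfCoprime, Units.val_one] at h
  rw [pow_add, hr, h, mul_one]

theorem IsSEDF.prod_primes_mul_pow_le {G : Type*} [CommGroup G] [Fintype G] [DecidableEq G]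
    {m : ℕ} (hm : 2 < m) {D : Fin m → Finset G} {k p n d t r : ℕ} (hp : p.Prime)
    (hD : IsSEDF D k (p ^ n)) (hd : 2 * d + 1 ≤ n) {q : Fin (t + 1) → ℕ}
    (hq : ∀ i, (q i).Prime) (hinj : Function.Injective q) (hdvd : ∀ i, q i ∣ Fintype.card G)
    (hpq : p.Coprime (∏ i, q i)) (hr : (p : ZMod (∏ i, q i)) ^ r = -1) :
    (∏ i, q i) * p ^ (d + 1) ≤ 2 ^ t * Fintype.card G := by
  classical
  have hlist0 := prod_div_ne_zero hq
  have hlist := fun k => exists_prod_div_mul_eq_zero hq (k := k)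
  have hexp : ∏ i, q i ∣ Monoid.exponent G := prod_primes_dvd_of_injective hq hinj fun i => by
    have := Fact.mk (hq i)
    obtain ⟨g, hg⟩ := exists_prime_orderOf_dvd_card (q i) (hdvd i)
    rw [← hg]
    exact Monoid.order_dvd_exponent g
  have hw1 : ∏ i, q i ≠ 1 := fun h => by
    have h0 := Finset.dvd_prod_of_mem q (Finset.mem_univ 0)
    rw [h, Nat.dvd_one] at h0
    exact (hq 0).ne_one h0
  have hw0 : 0 < ∏ i, q i := Finset.prod_pos fun i _ => (hq i).pos
  set l : Fin (t + 1) → ZMod (∏ i, q i) := fun i => (((∏ j, q j) / q i : ℕ) : ZMod (∏ j, q j))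
    with hl
  generalize (∏ i, q i) = w at *
  have : NeZero w := ⟨hw0.ne'⟩
  obtain ⟨s, hs0, hs⟩ := exists_ne_zero_pow_eq_neg_one hw0 hpq hr
  obtain ⟨χ, hχ⟩ := exists_character_orderOf_eq hexp
  have hχ1 : χ ≠ 1 := fun h => hw1 (by rw [← hχ, h, orderOf_one])
  have hmem : ∀ j, ∑ g ∈ D j, (χ g : ℂ) ∈ cyclotomicOrder w := fun j => sum_mem fun g _ => by
    obtain ⟨i, hi⟩ := exists_apply_eq_stdAddChar hχ g
    rw [hi]
    exact stdAddChar_mem_cyclotomicOrder i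
  have heq := hD.conj_sum_mul_eq hχ1
  obtain ⟨j, z, hz, hjz⟩ := exists_mul_conj_eq_pow_mul hm hp hmem heq
  obtain ⟨u, hu, hju⟩ := exists_eq_pow_mul_of_mul_conj_eq_pow_mul hp hs0 hs d (hmem j)
    (mul_mem (pow_mem (natCast_mem _ p) (n - (2 * d + 1))) hz) (by
      rw [hjz, ← mul_assoc, ← pow_add, Nat.add_sub_cancel' hd])
  obtain ⟨e, he⟩ := exists_eq_sum_of_mem_cyclotomicOrder hu
  have hne : ∑ g ∈ D j, (χ g : ℂ) ≠ 0 := fun h => by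
    have h1 := heq j
    rw [h, map_zero, zero_mul, zero_eq_neg] at h1
    exact pow_ne_zero n hp.ne_zero (by exact_mod_cast h1)
  have hcardle : ∀ i : ZMod w,
      ((((D j).filter fun g => (χ g : ℂ) = ZMod.stdAddChar i).card : ℕ) : ℤ)
        ≤ (Fintype.card G / w : ℕ) := fun i => by
    rw [← card_fiber_stdAddChar hχ i, Nat.mul_div_cancel_left _ hw0]
    exact_mod_cast Finset.card_le_card (Finset.filter_subset_filter _ (Finset.subset_univ _))
  rw [he, sum_character_eq_sum_stdAddChar hχ] at hju
  rw [sum_character_eq_sum_stdAddChar hχ] at hne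
  have hfin := ZMod.le_of_sum_stdAddChar_eq_mul (n := (p : ℤ) ^ (d + 1))
    (pow_pos (by exact_mod_cast hp.pos) _) (fun _ => Int.natCast_nonneg _) hcardle
    (l 0) (List.ofFn fun i => l (Fin.succ i))
    (by
      rw [← List.ofFn_succ]
      intro a ha
      obtain ⟨i, rfl⟩ := (List.mem_ofFn' _ _).1 ha
      exact hlist0 i)
    (by
      rw [← List.ofFn_succ]
      intro k hk
      obtain ⟨i, hi⟩ := hlist k hk
      exact ⟨l i, (List.mem_ofFn' _ _).2 ⟨i, rfl⟩, hi⟩)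
    (by push_cast at hju ⊢; exact hju) hne
  rw [List.length_ofFn] at hfin
  have hfin' : p ^ (d + 1) ≤ 2 ^ t * (Fintype.card G / w) := by exact_mod_cast hfin
  calc w * p ^ (d + 1) ≤ w * (2 ^ t * (Fintype.card G / w)) := Nat.mul_le_mul_left _ hfin'
    _ = 2 ^ t * (w * (Fintype.card G / w)) := by ring
    _ ≤ _ := Nat.mul_le_mul_left _ (Nat.mul_div_le _ _)

/-- Nonexistence of `((m-1)p₁^{2a+δ}p₂^{2c}+1, m, p₁^{a+b+δ}p₂^c, p₁^{2b+δ})`-SEDFs when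
`q_1, …, q_t` are distinct primes dividing `(m-1)p₁^{2a+δ}p₂^{2c}+1`, `p₁` is
self-conjugate modulo `q_1⋯q_t`, and
`q_1⋯q_t > 2^{t-1}·((m-1)p₁^{2a-b}p₂^{2c} + p₁^{-b})`. -/
theorem sedf_nonexistence_two_primes
    (p₁ p₂ : ℕ) (hp₁ : p₁.Prime) (hp₂ : p₂.Prime) (hne : p₁ ≠ p₂)
    (δ : ℕ) (hδ : δ = 0 ∨ δ = 1)
    (m a b c : ℕ) (hm : 2 < m) (ha : 0 < a) (hb : 0 < b) (hc : 0 < c)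
    (t : ℕ) (q : Fin t → ℕ) (hq : ∀ i, (q i).Prime) (hqinj : Function.Injective q)
    (hqdvd : ∀ i, q i ∣ (m - 1) * p₁ ^ (2 * a + δ) * p₂ ^ (2 * c) + 1)
    (hsc : SelfConjPrime p₁ (∏ i, q i))
    (hineq : (∏ i, (q i : ℝ)) >
      2 ^ (t - 1) * ((m - 1) * (p₁ : ℝ) ^ (2 * (a : ℤ) - (b : ℤ)) * (p₂ : ℝ) ^ (2 * c)
        + (p₁ : ℝ) ^ (-(b : ℤ)))) :
    ∀ (G : Type) [CommGroup G] [Fintype G] [DecidableEq G] (D : Fin m → Finset G),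
      Fintype.card G = (m - 1) * p₁ ^ (2 * a + δ) * p₂ ^ (2 * c) + 1 →
      ¬ IsSEDF D (p₁ ^ (a + b + δ) * p₂ ^ c) (p₁ ^ (2 * b + δ)) := by
  intro G _ _ _ D hcard hD
  have hm' : ((m - 1 : ℕ) : ℝ) = m - 1 := by
    rw [Nat.cast_sub (by omega), Nat.cast_one]
  have hp0 : (0 : ℝ) < p₁ := by exact_mod_cast hp₁.pos
  have hz1 : (p₁ : ℝ) ^ (2 * (a : ℤ) - b) * (p₁ : ℝ) ^ b = (p₁ : ℝ) ^ (2 * a) := by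
    rw [← zpow_natCast, ← zpow_natCast, ← zpow_add₀ hp0.ne']
    congr 1
    push_cast
    ring
  have hz2 : (p₁ : ℝ) ^ (-(b : ℤ)) * (p₁ : ℝ) ^ b = 1 := by
    rw [← zpow_natCast, ← zpow_add₀ hp0.ne', neg_add_cancel, zpow_zero]
  have hstrict : 2 ^ (t - 1) * ((m - 1) * p₁ ^ (2 * a) * p₂ ^ (2 * c) + 1)
      < (∏ i, q i) * p₁ ^ b := by
    have h := mul_lt_mul_of_pos_right hineq (pow_pos hp0 b)
    have h2 : (2 : ℝ) ^ (t - 1) * ((m - 1) * (p₁ : ℝ) ^ (2 * a) * (p₂ : ℝ) ^ (2 * c) + 1)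
        < (∏ i, (q i : ℝ)) * p₁ ^ b := by
      refine lt_of_eq_of_lt ?_ h
      rw [← hz1]
      linear_combination -(2 : ℝ) ^ (t - 1) * hz2
    rw [← hm'] at h2
    exact_mod_cast h2
  rcases t with _ | t
  · simp only [Finset.univ_eq_empty, Finset.prod_empty, one_mul] at hstrict
    have hk : p₁ ^ (a + b + δ) * p₂ ^ c ≤ Fintype.card G := by
      rw [← hD.2.2.2.1 ⟨0, by omega⟩]
      exact Finset.card_le_univ _
    rw [hcard] at hk
    have hb' : (m - 1) * p₁ ^ (2 * a) * p₂ ^ (2 * c) + 1 < p₁ ^ b := by simpa using hstrict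
    have h1 : 2 ≤ p₁ ^ a := hp₁.two_le.trans (Nat.le_self_pow ha.ne' _)
    have h2 : 1 ≤ p₂ ^ c := Nat.one_le_pow _ _ hp₂.pos
    have h3 : 1 ≤ p₁ ^ δ := Nat.one_le_pow _ _ hp₁.pos
    have h4 : p₁ ^ δ * p₁ ^ b * 2 ≤ p₁ ^ (a + b + δ) * p₂ ^ c := by
      calc p₁ ^ δ * p₁ ^ b * 2 ≤ p₁ ^ δ * p₁ ^ b * (p₁ ^ a * p₂ ^ c) :=
            Nat.mul_le_mul_left _ (by nlinarith)
        _ = _ := by ring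
    have h5 : (m - 1) * p₁ ^ (2 * a + δ) * p₂ ^ (2 * c) + 1 ≤ p₁ ^ δ * p₁ ^ b := by
      calc _ ≤ p₁ ^ δ * ((m - 1) * p₁ ^ (2 * a) * p₂ ^ (2 * c) + 1) := by
            rw [pow_add]; nlinarith
        _ ≤ _ := Nat.mul_le_mul_left _ hb'.le
    have h6 : 0 < p₁ ^ δ * p₁ ^ b := Nat.mul_pos h3 (pow_pos hp₁.pos b)
    omega
  · have hpq : p₁.Coprime (∏ i, q i) := Nat.Coprime.prod_right fun i _ => by
      rw [Nat.coprime_primes hp₁ (hq i)]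
      intro h
      have h1 := hqdvd i
      rw [← h, Nat.dvd_add_right (Dvd.dvd.mul_right (Dvd.dvd.mul_left
        (dvd_pow_self _ (by omega)) _) _)] at h1
      exact hp₁.one_lt.ne' (Nat.dvd_one.1 h1)
    obtain ⟨r, hr⟩ := hsc
    rw [Nat.factorization_eq_zero_of_not_dvd ((Nat.Prime.coprime_iff_not_dvd hp₁).1 hpq),
      pow_zero, Nat.div_one] at hr
    have hle := hD.prod_primes_mul_pow_le hm hp₁ (d := b + δ - 1) (by omega) hq hqinj
      (fun i => hcard ▸ hqdvd i) hpq hr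
    rw [Nat.sub_add_cancel (by omega), hcard] at hle
    have h3 : 1 ≤ p₁ ^ δ := Nat.one_le_pow _ _ hp₁.pos
    have h4 := Nat.mul_lt_mul_of_pos_right hstrict h3
    have h5 : 2 ^ t * ((m - 1) * p₁ ^ (2 * a + δ) * p₂ ^ (2 * c) + 1)
        ≤ 2 ^ t * ((m - 1) * p₁ ^ (2 * a) * p₂ ^ (2 * c) + 1) * p₁ ^ δ := by
      rw [mul_assoc (2 ^ t)]
      refine Nat.mul_le_mul_left _ ?_
      rw [pow_add]
      nlinarith
    rw [Nat.add_sub_cancel, mul_assoc (∏ i, q i), ← pow_add] at h4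
    omega
end

section
/- Suppose there exists a (v,m,k,λ)-SEDF in a finite abelian group G with m ≥ 3. Let p be an odd prime with p^a exactly dividing v, and let q be a prime divisor of λ. Then at least one of the following holds: (1) k·(m−2) ≡ 0 (mod p); (2) p^a divides m·k, and moreover, if q is self-conjugate modulo p and q^u exactly divides λ, then u is even. -/
/-- A quotient of algebraic integers that is rational is divisible in `ℤ`. -/
theorem Int.dvd_of_isIntegral {x : ℂ} (hx : IsIntegral ℤ x) {d n : ℤ} (hd : d ≠ 0)
    (h : d * x = n) : d ∣ n := by
  have hd' : (d : ℂ) ≠ 0 := by exact_mod_cast hd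
  have hxr : x = algebraMap ℚ ℂ ((n : ℚ) / d) := by
    simp only [eq_ratCast, Rat.cast_div, Rat.cast_intCast]
    field_simp
    rw [mul_comm, h]
  rw [hxr, isIntegral_algebraMap_iff (algebraMap ℚ ℂ).injective,
    IsIntegrallyClosed.isIntegral_iff] at hx
  obtain ⟨y, hy⟩ := hx
  refine ⟨y, ?_⟩
  have hd'' : (d : ℚ) ≠ 0 := by exact_mod_cast hd
  have : (y : ℚ) = n / d := by simpa using hy
  field_simp at this
  exact_mod_cast (by rw [← this, mul_comm] : (n : ℚ) = d * y)

theorem exists_ringHom_integralClosure_charP (p : ℕ) (hp : p.Prime) :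
    ∃ (K : Type) (_ : Field K) (_ : CharP K p), Nonempty (integralClosure ℤ ℂ →+* K) := by
  have hnu : (p : integralClosure ℤ ℂ) ∈ nonunits (integralClosure ℤ ℂ) := by
    intro hu
    obtain ⟨y, hy⟩ := hu.exists_right_inv
    have hdvd : (p : ℤ) ∣ 1 := by
      refine Int.dvd_of_isIntegral y.2 (by exact_mod_cast hp.ne_zero) ?_
      simpa using congrArg Subtype.val hy
    exact hp.one_lt.ne' (by exact_mod_cast Int.eq_one_of_dvd_one (by positivity) hdvd)
  obtain ⟨M, hM, hpM⟩ := exists_max_ideal_of_mem_nonunits hnu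
  let := Ideal.Quotient.field M
  refine ⟨_ ⧸ M, inferInstance, ?_, ⟨Ideal.Quotient.mk M⟩⟩
  rw [CharP.charP_iff_prime_eq_zero hp, ← map_natCast (Ideal.Quotient.mk M)]
  exact Ideal.Quotient.eq_zero_iff_mem.mpr hpM

namespace Polynomial

theorem expand_prime_pow_eq (q : ℕ) [Fact q.Prime] (n : ℕ) (f : ℤ[X]) :
    ∃ g : ℤ[X], expand ℤ (q ^ n) f = f ^ q ^ n + C (q : ℤ) * g := by
  have key (f : (ZMod q)[X]) : expand (ZMod q) (q ^ n) f = f ^ q ^ n := by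
    induction n with
    | zero => simp
    | succ n ih => rw [pow_succ, expand_mul, ZMod.expand_card, map_pow, ih, ← pow_mul]
  have hdvd : C (q : ℤ) ∣ expand ℤ (q ^ n) f - f ^ q ^ n := by
    rw [C_dvd_iff_dvd_coeff]
    intro i
    rw [← ZMod.intCast_zmod_eq_zero_iff_dvd, ← eq_intCast (Int.castRingHom (ZMod q)), ← coeff_map,
      Polynomial.map_sub, map_expand, Polynomial.map_pow, key, sub_self, coeff_zero]
  obtain ⟨g, hg⟩ := hdvd
  exact ⟨g, by rw [← hg]; ring⟩

theorem isIntegral_aeval_of_isIntegral {z : ℂ} (hz : IsIntegral ℤ z) (f : ℤ[X]) :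
    IsIntegral ℤ (aeval z f) := by
  have := (aeval (⟨z, hz⟩ : integralClosure ℤ ℂ) f).2
  rwa [aeval_subalgebra_coe] at this

/-- If `q` is self-conjugate modulo the order of `z`, the squared modulus of an element of `ℤ[z]`
has even `q`-adic valuation as soon as it is an integer. -/
theorem even_padicValNat_of_aeval_mul_conj {q r : ℕ} [Fact q.Prime] (hr : 1 ≤ r) {z : ℂ}
    (hz : starRingEnd ℂ z = z ^ q ^ r) (hint : IsIntegral ℤ z) (n : ℕ) (hn : 0 < n)
    (f : ℤ[X]) (hf : aeval z f * starRingEnd ℂ (aeval z f) = n) :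
    Even (padicValNat q n) := by
  induction n using Nat.strong_induction_on generalizing f with
  | _ n ih =>
  have hq : q.Prime := Fact.out
  have hq0 : (q : ℂ) ≠ 0 := by exact_mod_cast hq.ne_zero
  by_cases hqn : q ∣ n
  swap
  · simp [padicValNat.eq_zero_of_not_dvd hqn]
  obtain ⟨n', rfl⟩ := hqn
  have hconj (g : ℤ[X]) : starRingEnd ℂ (aeval z g) = aeval (starRingEnd ℂ z) g := by
    rw [aeval_def, aeval_def, hom_eval₂]
    congr 1
    ext; simp
  have hzz : z ^ q ^ (r + r) = z := by
    rw [pow_add, pow_mul, ← hz, ← map_pow, ← hz, Complex.conj_conj]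
  obtain ⟨g₁, h₁⟩ := expand_prime_pow_eq q r f
  obtain ⟨g₂, h₂⟩ := expand_prime_pow_eq q (r + r) f
  have e₁ := congrArg (aeval z) h₁
  have e₂ := congrArg (aeval z) h₂
  simp only [expand_aeval, map_add, map_mul, map_pow, map_natCast,
    hzz, ← hz, ← hconj] at e₁ e₂
  obtain ⟨t, ht⟩ : ∃ t, q ^ (r + r) = q ^ r + 1 + t := by
    refine Nat.exists_eq_add_of_le ?_
    have : 2 ≤ q ^ r := hq.two_le.trans (Nat.le_self_pow (by omega) q)
    rw [pow_add]
    nlinarith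
  set h : ℤ[X] := (C (n' : ℤ) - f * g₁) * f ^ t + g₂ with hh
  have hfh : aeval z f = q * aeval z h := by
    rw [e₂, ht, hh]
    push_cast at hf
    simp only [map_add, map_mul, map_pow, map_sub, map_natCast]
    rw [pow_add, pow_succ]
    linear_combination (aeval z f) ^ t * hf - (aeval z f) ^ t * (aeval z f) * e₁
  have hn' : (q : ℂ) * (aeval z h * starRingEnd ℂ (aeval z h)) = n' := by
    rw [hfh] at hf
    push_cast at hf
    simp only [map_mul, Complex.conj_natCast] at hf
    refine mul_left_cancel₀ hq0 ?_
    linear_combination hf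
  have hdvd : (q : ℤ) ∣ n' := by
    refine Int.dvd_of_isIntegral ((isIntegral_aeval_of_isIntegral hint h).mul ?_)
      (by exact_mod_cast hq.ne_zero) (by simpa using hn')
    rw [hconj, hz]
    exact isIntegral_aeval_of_isIntegral (hint.pow _) h
  obtain ⟨n₁, rfl⟩ := Int.natCast_dvd_natCast.mp hdvd
  have hn₁ : 0 < n₁ := Nat.pos_of_mul_pos_left (Nat.pos_of_mul_pos_left hn)
  have hlt : n₁ < q * (q * n₁) := by nlinarith [hq.two_le, Nat.mul_le_mul hq.two_le hq.two_le]
  have hev := ih n₁ hlt hn₁ h (by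
    refine mul_left_cancel₀ hq0 ?_
    rw [hn']
    push_cast
    ring)
  rw [padicValNat.mul hq.ne_zero (Nat.pos_of_mul_pos_left hn).ne',
    padicValNat.mul hq.ne_zero hn₁.ne',
    padicValNat.self hq.one_lt, ← add_assoc]
  exact Even.add (by decide) hev

end Polynomial

/-- The sum of the values of a character over a finite set. -/
noncomputable def charSum {G : Type*} [CommGroup G] (χ : G →* ℂˣ) (s : Finset G) : ℂ :=
  ∑ x ∈ s, (χ x : ℂ)

section CharSum

variable {G : Type*} [CommGroup G] {χ : G →* ℂˣ}

theorem coe_apply_pow_eq_one {n : ℕ} (hχ : χ ^ n = 1) (x : G) : (χ x : ℂ) ^ n = 1 := by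
  rw [← Units.val_pow_eq_pow_val, ← MonoidHom.pow_apply, hχ, MonoidHom.one_apply, Units.val_one]

theorem norm_apply_eq_one_of_pow_eq_one {n : ℕ} (hn : n ≠ 0) (hχ : χ ^ n = 1) (x : G) :
    ‖(χ x : ℂ)‖ = 1 :=
  Complex.norm_eq_one_of_pow_eq_one (coe_apply_pow_eq_one hχ x) hn

theorem conj_charSum {n : ℕ} (hn : n ≠ 0) (hχ : χ ^ n = 1) (s : Finset G) :
    starRingEnd ℂ (charSum χ s) = charSum χ⁻¹ s := by
  simp only [charSum, map_sum]
  refine Finset.sum_congr rfl fun x _ => ?_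
  rw [← Complex.inv_eq_conj (norm_apply_eq_one_of_pow_eq_one hn hχ x)]
  simp

/-- Modulo a prime above `p`, a character of `p`-power order is trivial. -/
theorem exists_integral_charSum {p n : ℕ} [Fact p.Prime] (hχ : χ ^ p ^ n = 1) (s : Finset G)
    {K : Type*} [Field K] [CharP K p] (φ : integralClosure ℤ ℂ →+* K) :
    ∃ y : integralClosure ℤ ℂ, (y : ℂ) = charSum χ s ∧ φ y = s.card := by
  have hpow := coe_apply_pow_eq_one hχ
  have hp : 0 < p ^ n := pow_pos (Fact.out : p.Prime).pos n
  have hint (x : G) : IsIntegral ℤ (χ x : ℂ) := by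
    refine IsIntegral.of_pow hp ?_
    rw [hpow]
    exact isIntegral_one
  refine ⟨∑ x ∈ s, ⟨χ x, hint x⟩, by simp [charSum], ?_⟩
  rw [map_sum, Finset.card_eq_sum_ones, Nat.cast_sum]
  refine Finset.sum_congr rfl fun x _ => ?_
  have : ExpChar K p := .prime Fact.out
  have h1 : φ ⟨χ x, hint x⟩ ^ (p ^ n * 1) = 1 := by
    rw [← map_pow, mul_one]
    convert map_one φ
    exact Subtype.ext (hpow x)
  rw [ExpChar.pow_prime_pow_mul_eq_one_iff, pow_one] at h1
  simpa using h1

theorem exists_aeval_eq_charSum {n : ℕ} [NeZero n] (hχ : χ ^ n = 1) {z : ℂ}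
    (hz : IsPrimitiveRoot z n) (s : Finset G) :
    ∃ f : Polynomial ℤ, Polynomial.aeval z f = charSum χ s := by
  have hpow (x : G) : ∃ i : ℕ, z ^ i = χ x := by
    obtain ⟨i, -, hi⟩ := hz.eq_pow_of_pow_eq_one (coe_apply_pow_eq_one hχ x)
    exact ⟨i, hi⟩
  choose i hi using hpow
  exact ⟨∑ x ∈ s, Polynomial.X ^ i x, by simp [charSum, hi]⟩

theorem sum_apply_eq_zero [Fintype G] (hχ : χ ≠ 1) : ∑ g, (χ g : ℂ) = 0 := by
  refine sum_hom_units_eq_zero ((Units.coeHom ℂ).comp χ) fun h => hχ ?_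
  ext g
  simpa using DFunLike.congr_fun h g

/-- Summing over a group `S` of characters all of whose nontrivial members vanish on `s`. -/
theorem card_subgroup_dvd_of_charSum_eq_zero [Fintype G] (S : Subgroup (G →* ℂˣ)) (s : Finset G)
    (h : ∀ χ ∈ S, χ ≠ 1 → charSum χ s = 0) : Nat.card S ∣ s.card := by
  classical
  have : Finite (G →* ℂˣ) := Nat.finite_of_card_ne_zero (by
    rw [CommGroup.card_monoidHom_of_hasEnoughRootsOfUnity G ℂ]
    exact Nat.card_pos.ne')
  have := Fintype.ofFinite S
  have h₁ : ∑ χ : S, charSum χ.1 s = s.card := by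
    rw [Fintype.sum_eq_single (1 : S) fun χ hχ => h χ.1 χ.2 (by simpa using hχ)]
    simp [charSum]
  have h₂ (x : G) : ∃ c : ℕ, ∑ χ : S, (χ.1 x : ℂ) = Nat.card S * c := by
    let e : S →* ℂ := (Units.coeHom ℂ).comp ((MonoidHom.eval x).comp S.subtype)
    have := sum_hom_units e
    refine ⟨if e = 1 then 1 else 0, ?_⟩
    rw [Nat.card_eq_fintype_card]
    split_ifs at this ⊢ <;> simpa [e] using this
  choose c hc using h₂
  simp only [charSum] at h₁
  rw [Finset.sum_comm, Finset.sum_congr rfl fun x _ => hc x, ← Finset.mul_sum] at h₁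
  exact ⟨∑ x ∈ s, c x, by exact_mod_cast h₁.symm⟩

end CharSum

namespace IsSEDF

variable {G : Type*} [CommGroup G] [Fintype G] [DecidableEq G] {m k lam : ℕ}
  {D : Fin m → Finset G}

theorem charSum_eq (h : IsSEDF D k lam) {χ : G →* ℂˣ} (hχ : χ ≠ 1) (j : Fin m) :
    ((∑ l, charSum χ (D l)) - charSum χ (D j)) * charSum χ⁻¹ (D j) = -lam := by
  have hcount := h.2.2.2.2.2 j
  have h₁ : ∑ g : G, (χ g : ℂ) * ((if g = 1 then 0 else lam : ℕ) : ℂ) = -lam := by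
    have : ∀ g : G, (χ g : ℂ) * ((if g = 1 then 0 else lam : ℕ) : ℂ)
        = χ g * lam - if g = 1 then (lam : ℂ) else 0 := by
      intro g
      split_ifs with hg <;> simp [hg]
    simp only [this, Finset.sum_sub_distrib, ← Finset.sum_mul, sum_apply_eq_zero hχ]
    simp
  rw [← h₁]
  simp only [← hcount, Nat.cast_sum, Finset.mul_sum]
  rw [Finset.sum_comm]
  have h₂ : (∑ l, charSum χ (D l)) - charSum χ (D j)
      = ∑ l ∈ Finset.univ.filter (fun l => l ≠ j), charSum χ (D l) := by
    rw [Finset.filter_ne', ← Finset.add_sum_erase _ _ (Finset.mem_univ j)]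
    ring
  rw [h₂, Finset.sum_mul]
  refine Finset.sum_congr rfl fun l _ => ?_
  rw [charSum, charSum, Finset.sum_mul_sum, ← Finset.sum_product',
    ← Finset.sum_fiberwise (D l ×ˢ D j) (fun x => x.1 * x.2⁻¹)]
  refine Finset.sum_congr rfl fun g _ => ?_
  rw [Finset.sum_congr rfl (g := fun _ => (χ g : ℂ)), Finset.sum_const, nsmul_eq_mul, mul_comm]
  intro x hx
  rw [← (Finset.mem_filter.mp hx).2]
  simp

/-- Either the union of the blocks vanishes at `χ`, or two blocks add up to it. -/
theorem charSum_eq_zero_or (h : IsSEDF D k lam) {χ : G →* ℂˣ} (hχ : χ ≠ 1) {n : ℕ} (hn : n ≠ 0)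
    (hχn : χ ^ n = 1) :
    (∑ l, charSum χ (D l)) = 0 ∨
      ∃ i j, charSum χ (D i) + charSum χ (D j) = ∑ l, charSum χ (D l) := by
  by_contra! hcon
  obtain ⟨hX, hne⟩ := hcon
  have heq := h.charSum_eq hχ
  simp only [← conj_charSum hn hχn] at heq
  obtain ⟨hm, -, hlam, -⟩ := h
  set X := ∑ l, charSum χ (D l) with hXdef
  have hN : 0 < Complex.normSq X := Complex.normSq_pos.mpr hX
  set t : ℝ := lam / Complex.normSq X with ht
  have htpos : 0 < t := by positivity
  have hreal (j : Fin m) : ∃ a : ℝ, charSum χ (D j) = a * X ∧ a * (a - 1) = t := by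
    set x := charSum χ (D j)
    have h₁ : X * starRingEnd ℂ x = ((Complex.normSq x - lam : ℝ) : ℂ) := by
      push_cast
      rw [← Complex.mul_conj]
      linear_combination heq j
    have h₂ : starRingEnd ℂ X * x = ((Complex.normSq x - lam : ℝ) : ℂ) := by
      simpa using congrArg (starRingEnd ℂ) h₁
    have h₃ : x = ((Complex.normSq x - lam) / Complex.normSq X : ℝ) * X := by
      have hNC : (Complex.normSq X : ℂ) ≠ 0 := by exact_mod_cast hN.ne'
      rw [Complex.ofReal_div, div_mul_eq_mul_div, eq_div_iff hNC, ← h₂, ← Complex.mul_conj]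
      ring
    refine ⟨_, h₃, ?_⟩
    have h₄ : Complex.normSq x = ((Complex.normSq x - lam) / Complex.normSq X) ^ 2
        * Complex.normSq X := by
      conv_lhs => rw [h₃, Complex.normSq_mul, Complex.normSq_ofReal]
      ring
    rw [ht]
    field_simp at h₄ ⊢
    linarith
  choose a ha hat using hreal
  have hsum : ∑ j, a j = 1 := by
    have : (((∑ j, a j : ℝ) : ℂ)) * X = 1 * X := by
      rw [Complex.ofReal_sum, Finset.sum_mul, one_mul, hXdef]
      exact Finset.sum_congr rfl fun j _ => (ha j).symm
    exact_mod_cast mul_right_cancel₀ hX this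
  let j₀ : Fin m := ⟨0, hm⟩
  have hall (j : Fin m) : a j = a j₀ := by
    have h0 : (a j - a j₀) * (a j + a j₀ - 1) = 0 := by
      linear_combination hat j - hat j₀
    rcases mul_eq_zero.mp h0 with h0 | h0
    · linarith
    · refine absurd ?_ (hne j j₀)
      rw [ha, ha, ← add_mul, ← Complex.ofReal_add, show a j + a j₀ = 1 by linarith]
      simp
  simp only [hall, Finset.sum_const, Finset.card_univ, Fintype.card_fin, nsmul_eq_mul] at hsum
  have hm1 : (1 : ℝ) ≤ m := by exact_mod_cast hm
  have := hat j₀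
  have hpos : 0 < a j₀ := by
    by_contra! h0
    nlinarith
  have hle : a j₀ ≤ 1 := by nlinarith
  nlinarith

end IsSEDF

/-- Suppose there exists a `(v,m,k,λ)`-SEDF in `G` with `m ≥ 3`, let `p` be an odd prime
with `p^a ∥ v` (`a ≥ 1`), and let `q` be a prime divisor of `λ`.  Then either
`k(m-2) ≡ 0 (mod p)`, or `p^a ∣ mk` and moreover whenever `q` is self-conjugate
modulo `p` and `q^u ∥ λ`, `u` is even. -/
theorem sedf_divisibility_dichotomy {G : Type*} [CommGroup G] [Fintype G] [DecidableEq G]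
    {v m k lam : ℕ} (hv : Fintype.card G = v)
    (D : Fin m → Finset G) (h : IsSEDF D k lam) (hm : 3 ≤ m)
    (p : ℕ) (hp : p.Prime) (hodd : Odd p)
    (a : ℕ) (ha : 0 < a) (hpa : p ^ a ∣ v ∧ ¬ p ^ (a + 1) ∣ v)
    (q : ℕ) (hq : q.Prime) (hqlam : q ∣ lam) :
    p ∣ k * (m - 2) ∨
    (p ^ a ∣ m * k ∧
      (SelfConjPrime q p → ∀ u : ℕ, (q ^ u ∣ lam ∧ ¬ q ^ (u + 1) ∣ lam) → Even u)) := by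
  have : Fact p.Prime := ⟨hp⟩
  have : Fact q.Prime := ⟨hq⟩
  rw [or_iff_not_imp_left]
  intro hnd
  obtain ⟨K, _, _, ⟨φ⟩⟩ := exists_ringHom_integralClosure_charP p hp
  have hcard := h.2.2.2.1
  have hlam := h.2.2.1
  have hzero (χ : G →* ℂˣ) (hχ : χ ≠ 1) (n : ℕ) (hχn : χ ^ p ^ n = 1) :
      ∑ l, charSum χ (D l) = 0 := by
    have hpn : p ^ n ≠ 0 := pow_ne_zero n hp.ne_zero
    refine (h.charSum_eq_zero_or hχ hpn hχn).resolve_right ?_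
    rintro ⟨i, j, hij⟩
    apply hnd
    choose y hy hyφ using fun l => exists_integral_charSum hχn (D l) φ
    have hR : y i + y j = ∑ l, y l := Subtype.ext (by simpa [hy] using hij)
    have hK := congrArg φ hR
    simp only [map_add, map_sum, hyφ, hcard, Finset.sum_const, Finset.card_univ,
      Fintype.card_fin, nsmul_eq_mul] at hK
    rw [← CharP.cast_eq_zero_iff K p, Nat.cast_mul, Nat.cast_sub (by omega)]
    push_cast
    linear_combination -hK
  have hdualcard : Nat.card (G →* ℂˣ) = v := by
    rw [CommGroup.card_monoidHom_of_hasEnoughRootsOfUnity G ℂ, Nat.card_eq_fintype_card, hv]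
  have : Finite (G →* ℂˣ) := Nat.finite_of_card_ne_zero (by
    rw [hdualcard, ← hv]
    exact Fintype.card_ne_zero)
  refine ⟨?_, fun hself u hu => ?_⟩
  · obtain ⟨S, hS⟩ := Sylow.exists_subgroup_card_pow_prime p (hdualcard.symm ▸ hpa.1)
    have hU : (Finset.univ.biUnion D).card = m * k := by
      rw [Finset.card_biUnion fun i _ j _ hij => h.2.2.2.2.1 i j hij]
      simp [hcard]
    rw [← hS, ← hU]
    refine card_subgroup_dvd_of_charSum_eq_zero S _ fun χ hχS hχ => ?_
    rw [charSum, Finset.sum_biUnion fun i _ j _ hij => h.2.2.2.2.1 i j hij]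
    refine hzero χ hχ a ?_
    have := pow_card_eq_one' (x := (⟨χ, hχS⟩ : S))
    rw [hS] at this
    exact congrArg Subtype.val this
  · obtain ⟨χ, hχ⟩ := exists_prime_orderOf_dvd_card' (G := G →* ℂˣ) p
      (hdualcard.symm ▸ (dvd_pow_self p ha.ne').trans hpa.1)
    have hχp : χ ^ p = 1 := hχ ▸ pow_orderOf_eq_one χ
    have hχ1 : χ ≠ 1 := by
      rintro rfl
      exact hp.one_lt.ne' (by simpa using hχ.symm)
    let j : Fin m := ⟨0, by omega⟩
    have hprod : charSum χ (D j) * charSum χ⁻¹ (D j) = lam := by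
      have := h.charSum_eq hχ1 j
      rw [hzero χ hχ1 1 (by simpa using hχp)] at this
      linear_combination -this
    have hqp : q ≠ p := by
      rintro rfl
      apply hnd
      obtain ⟨y, hy, hyφ⟩ := exists_integral_charSum (n := 1) (by simpa using hχp) (D j) φ
      obtain ⟨y', hy', hyφ'⟩ := exists_integral_charSum (χ := χ⁻¹) (n := 1)
        (by rw [pow_one]; exact (inv_pow χ q).trans (inv_eq_one.mpr hχp)) (D j) φ
      have hR : y * y' = (lam : integralClosure ℤ ℂ) :=
        Subtype.ext (by simpa [hy, hy'] using hprod)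
      have hK := congrArg φ hR
      rw [map_mul, hyφ, hyφ', hcard, map_natCast, (CharP.cast_eq_zero_iff K q lam).mpr hqlam,
        mul_self_eq_zero, CharP.cast_eq_zero_iff K q] at hK
      exact hK.mul_right _
    obtain ⟨r, hr⟩ := hself
    rw [Nat.factorization_eq_zero_of_not_dvd
      (fun hd => hqp ((Nat.prime_dvd_prime_iff_eq hq hp).mp hd)), pow_zero, Nat.div_one] at hr
    have hr1 : 1 ≤ r := by
      by_contra! h0
      obtain rfl : r = 0 := by omega
      have : Fact (2 < p) := ⟨by have := hp.two_le; obtain ⟨c, rfl⟩ := hodd; omega⟩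
      exact ZMod.neg_one_ne_one (by simpa using hr.symm)
    obtain ⟨c, hc⟩ : p ∣ q ^ r + 1 := by
      rw [← ZMod.natCast_eq_zero_iff]
      push_cast
      rw [hr]
      ring
    have hz := Complex.isPrimitiveRoot_exp p hp.ne_zero
    set z := Complex.exp (2 * Real.pi * Complex.I / p)
    have hz1 : ‖z‖ = 1 := hz.norm'_eq_one hp.ne_zero
    obtain ⟨f, hf⟩ := exists_aeval_eq_charSum hχp hz (D j)
    have hev : Even (padicValNat q lam) := by
      refine Polynomial.even_padicValNat_of_aeval_mul_conj hr1 ?_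
        (hz.isIntegral hp.pos) lam hlam f ?_
      · rw [← Complex.inv_eq_conj hz1]
        refine inv_eq_of_mul_eq_one_right ?_
        rw [← pow_succ', hc, pow_mul, hz.pow_eq_one, one_pow]
      · rw [hf, conj_charSum hp.ne_zero hχp, hprod]
    convert hev
    refine le_antisymm ((padicValNat_dvd_iff_le hlam.ne').mp hu.1) ?_
    by_contra! hlt
    exact hu.2 ((padicValNat_dvd_iff_le hlam.ne').mpr hlt)
end

section
/- Suppose there exists a (v,m,k,λ)-SEDF in a finite abelian group G with m ≥ 3. Let p > 2 be a prime divisor of v and write v = p^a·v' with gcd(v',p) = 1. If p^a does not divide m·k, then k·(m−2) ≡ 0 (mod p). -/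
open scoped ComplexConjugate

/-- A vanishing integer combination of complex `p`-power roots of unity has coefficient sum
divisible by `p`. -/
theorem dvd_sum_of_sum_mul_rootsOfUnity_eq_zero {ι : Type*} (s : Finset ι) {p n : ℕ}
    (hp : p.Prime) (c : ι → ℤ) (z : ι → ℂ) (hz : ∀ i, z i ^ p ^ n = 1)
    (hsum : ∑ i ∈ s, (c i : ℂ) * z i = 0) : (p : ℤ) ∣ ∑ i ∈ s, c i := by
  have hpint : Prime (p : ℤ) := Nat.prime_iff_prime_int.mp hp
  have hmax : (Ideal.span {(p : ℤ)}).IsMaximal :=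
    PrincipalIdealRing.isMaximal_of_irreducible hpint.irreducible
  obtain ⟨M, hM, hMp⟩ := Ideal.exists_ideal_over_maximal_of_isIntegral
    (S := integralClosure ℤ ℂ) (Ideal.span {(p : ℤ)})
    (by
      rw [(RingHom.injective_iff_ker_eq_bot _).mp
        (FaithfulSMul.algebraMap_injective ℤ (integralClosure ℤ ℂ))]
      exact bot_le)
  have hmem (b : ℤ) : (b : integralClosure ℤ ℂ) ∈ M ↔ (p : ℤ) ∣ b := by
    rw [← Ideal.mem_span_singleton, ← hMp]
    simp
  have : Fact p.Prime := ⟨hp⟩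
  have : CharP (integralClosure ℤ ℂ ⧸ M) p := by
    refine ⟨fun b => ?_⟩
    rw [← Int.natCast_dvd_natCast, ← hmem, ← Ideal.Quotient.eq_zero_iff_mem]
    simp
  have hint (i : ι) : z i ∈ integralClosure ℤ ℂ :=
    IsIntegral.of_pow (pow_pos hp.pos n) (by rw [hz]; exact isIntegral_one)
  let w (i : ι) : integralClosure ℤ ℂ := ⟨z i, hint i⟩
  have hw (i : ι) : Ideal.Quotient.mk M (w i) = 1 := by
    have h1 : w i ^ p ^ n = 1 := Subtype.ext (hz i)
    have h2 : (Ideal.Quotient.mk M (w i) - 1) ^ p ^ n = 0 := by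
      rw [sub_pow_char_pow, ← map_pow, h1]
      simp
    exact sub_eq_zero.mp (pow_eq_zero_iff (pow_pos hp.pos n).ne' |>.mp h2)
  have hsum' : ∑ i ∈ s, (c i : integralClosure ℤ ℂ) * w i = 0 := by
    apply Subtype.ext
    simpa [w] using hsum
  have := congrArg (Ideal.Quotient.mk M) hsum'
  rw [← hmem, ← Ideal.Quotient.eq_zero_iff_mem]
  simpa [hw] using this

section Characters

variable {G : Type*} [CommGroup G]

theorem conj_character_apply [Finite G] (χ : G →* ℂˣ) (g : G) :
    conj (χ g : ℂ) = (χ g⁻¹ : ℂ) := by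
  have h : ‖(χ g : ℂ)‖ = 1 :=
    Complex.norm_eq_one_of_pow_eq_one (n := Nat.card G)
      (by rw [← Units.val_pow_eq_pow_val, ← map_pow, pow_card_eq_one']; simp) Nat.card_pos.ne'
  rw [← Complex.inv_eq_conj h, map_inv, Units.val_inv_eq_inv_val]

theorem sum_character_eq_zero [Fintype G] {χ : G →* ℂˣ} (hχ : χ ≠ 1) :
    ∑ g, (χ g : ℂ) = 0 := by
  refine sum_hom_units_eq_zero ((Units.coeHom ℂ).comp χ) fun h => hχ ?_
  ext g
  simpa using DFunLike.congr_fun h g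

/-- If every nontrivial character in a subgroup `K` of the dual group sums to zero over the
family `D`, then the order of `K` divides the total size of the family. -/
theorem card_dvd_of_sum_character_eq_zero [Finite G] {ι : Type*} [Fintype ι] (D : ι → Finset G)
    (K : Subgroup (G →* ℂˣ))
    (hK : ∀ χ ∈ K, χ ≠ 1 → ∑ i, ∑ g ∈ D i, (χ g : ℂ) = 0) :
    Nat.card K ∣ ∑ i, (D i).card := by
  classical
  have : Finite (G →* ℂˣ) :=
    Finite.of_equiv _ (CommGroup.monoidHom_mulEquiv_of_hasEnoughRootsOfUnity G ℂ).some.symm.toEquiv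
  have := Fintype.ofFinite K
  let ev (g : G) : K →* ℂ :=
    (Units.coeHom ℂ).comp ((MonoidHom.eval g).comp K.subtype)
  have h1 : ∑ χ : K, ∑ i, ∑ g ∈ D i, (χ.1 g : ℂ) = ∑ i, (D i).card := by
    rw [Finset.sum_eq_single 1]
    · simp
    · intro χ _ hχ
      exact hK χ χ.2 (by simpa using hχ)
    · simp
  have h2 (g : G) : ∑ χ : K, (χ.1 g : ℂ) = if ev g = 1 then (Fintype.card K : ℂ) else 0 := by
    simpa [ev] using sum_hom_units (ev g)
  rw [Finset.sum_comm] at h1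
  simp_rw [Finset.sum_comm (s := Finset.univ (α := K)), h2] at h1
  have h3 : Fintype.card K * ∑ i, ∑ g ∈ D i, (if ev g = 1 then 1 else 0) = ∑ i, (D i).card := by
    have : ((Fintype.card K * ∑ i, ∑ g ∈ D i, (if ev g = 1 then 1 else 0) : ℕ) : ℂ)
        = (∑ i, (D i).card : ℕ) := by
      push_cast at h1 ⊢
      rw [← h1]
      simp_rw [Finset.mul_sum, mul_ite, mul_one, mul_zero]
    exact_mod_cast this
  rw [Nat.card_eq_fintype_card]
  exact Dvd.intro _ h3

/-- The character form of the defining equation of a strong external difference family. -/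
theorem IsSEDF.sum_character_mul_conj [Fintype G] [DecidableEq G] {m k lam : ℕ}
    {D : Fin m → Finset G} (h : IsSEDF D k lam) {χ : G →* ℂˣ} (hχ : χ ≠ 1) (j : Fin m) :
    (∑ i, ∑ g ∈ D i, (χ g : ℂ)) * conj (∑ g ∈ D j, (χ g : ℂ)) =
      (∑ g ∈ D j, (χ g : ℂ)) * conj (∑ g ∈ D j, (χ g : ℂ)) - lam := by
  obtain ⟨-, -, -, -, -, hD⟩ := h
  have hpair (l : Fin m) : (∑ g ∈ D l, (χ g : ℂ)) * conj (∑ g ∈ D j, (χ g : ℂ)) =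
      ∑ g, (χ g : ℂ) * (((D l) ×ˢ (D j)).filter (fun x => x.1 * x.2⁻¹ = g)).card := by
    rw [map_sum, Finset.sum_mul_sum, ← Finset.sum_product',
      ← Finset.sum_fiberwise (D l ×ˢ D j) (fun x => x.1 * x.2⁻¹)]
    refine Finset.sum_congr rfl fun g _ => ?_
    rw [mul_comm, ← nsmul_eq_mul]
    refine Finset.sum_eq_card_nsmul fun x hx => ?_
    rw [← (Finset.mem_filter.mp hx).2, conj_character_apply, map_mul, Units.val_mul]
  have hsum : ∑ l ∈ Finset.univ.filter (fun l => l ≠ j),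
      (∑ g ∈ D l, (χ g : ℂ)) * conj (∑ g ∈ D j, (χ g : ℂ)) = -lam := by
    simp_rw [hpair]
    rw [Finset.sum_comm]
    simp_rw [← Finset.mul_sum, ← Nat.cast_sum, hD]
    have := sum_character_eq_zero hχ
    rw [← Finset.add_sum_erase _ _ (Finset.mem_univ 1)] at this ⊢
    rw [Finset.sum_congr rfl (g := fun g => (χ g : ℂ) * lam)
      (fun g hg => by rw [if_neg (Finset.ne_of_mem_erase hg)]), ← Finset.sum_mul]
    simp only [map_one, Units.val_one, if_true, Nat.cast_zero, mul_zero, zero_add] at this ⊢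
    linear_combination (lam : ℂ) * this
  rw [Finset.sum_mul, ← Finset.add_sum_erase _ _ (Finset.mem_univ j), ← Finset.filter_ne', hsum]
  ring

end Characters

/-- Two solutions `x`, `y` of `X z̄ = z z̄ - r` with `X ≠ 0` and `r` real are equal or add up
to `X`. -/
theorem eq_or_add_eq_of_mul_conj_eq {X x y : ℂ} {r : ℝ} (hX : X ≠ 0)
    (hx : X * conj x = x * conj x - r) (hy : X * conj y = y * conj y - r) :
    y = x ∨ x + y = X := by
  have hX' : conj X ≠ 0 := by simpa using hX
  have hx' : conj X * x = x * conj x - r := by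
    have := congrArg conj hx
    simp only [map_mul, map_sub, Complex.conj_conj, Complex.conj_ofReal] at this
    rw [this]; ring
  have hy' : conj X * y = y * conj y - r := by
    have := congrArg conj hy
    simp only [map_mul, map_sub, Complex.conj_conj, Complex.conj_ofReal] at this
    rw [this]; ring
  have quad {z : ℂ} (h : X * conj z = z * conj z - r) (h' : conj X * z = z * conj z - r) :
      (conj X * z) ^ 2 - X * conj X * (conj X * z) - r * (X * conj X) = 0 := by
    linear_combination (-X * conj X) * h' + conj X * z * (h' - h)
  have key : conj X ^ 2 * ((y - x) * (x + y - X)) = 0 := by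
    linear_combination quad hy hy' - quad hx hx'
  rcases mul_eq_zero.mp (mul_eq_zero.mp key |>.resolve_left (pow_ne_zero 2 hX')) with h | h
  · exact Or.inl (sub_eq_zero.mp h)
  · exact Or.inr (sub_eq_zero.mp h)

/-- If there exists a `(v,m,k,λ)`-SEDF in `G` with `m ≥ 3`, `p > 2` is a prime divisor
of `v` with `v = p^a · v'`, `gcd(v',p) = 1`, and `p^a ∤ mk`, then
`k(m-2) ≡ 0 (mod p)`. -/
theorem sedf_km2_divisible {G : Type*} [CommGroup G] [Fintype G] [DecidableEq G]
    {v m k lam : ℕ} (hv : Fintype.card G = v)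
    (D : Fin m → Finset G) (h : IsSEDF D k lam) (hm : 3 ≤ m)
    (p : ℕ) (hp : p.Prime) (hp2 : 2 < p) (hpv : p ∣ v)
    (a v' : ℕ) (hva : v = p ^ a * v') (hgcd : Nat.Coprime v' p)
    (hmk : ¬ p ^ a ∣ m * k) :
    p ∣ k * (m - 2) := by
  have hcard := h.2.2.2.1
  have hlam := h.2.2.1
  have : Fact p.Prime := ⟨hp⟩
  have : Finite (G →* ℂˣ) :=
    Finite.of_equiv _ (CommGroup.monoidHom_mulEquiv_of_hasEnoughRootsOfUnity G ℂ).some.symm.toEquiv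
  obtain ⟨K, hK⟩ := Sylow.exists_subgroup_card_pow_prime (G := G →* ℂˣ) p (n := a) (by
    rw [CommGroup.card_monoidHom_of_hasEnoughRootsOfUnity, Nat.card_eq_fintype_card, hv, hva]
    exact Dvd.intro _ rfl)
  obtain ⟨χ, hχK, hχ, hX⟩ : ∃ χ ∈ K, χ ≠ 1 ∧ ∑ i, ∑ g ∈ D i, (χ g : ℂ) ≠ 0 := by
    by_contra! hcon
    apply hmk
    simpa [hK, hcard] using card_dvd_of_sum_character_eq_zero D K hcon
  have hroot (g : G) : (χ g : ℂ) ^ p ^ a = 1 := by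
    have h1 : χ ^ p ^ a = 1 := by
      have := pow_card_eq_one' (x := (⟨χ, hχK⟩ : K))
      rw [hK] at this
      simpa using congrArg Subtype.val this
    simpa using congrArg Units.val (DFunLike.congr_fun h1 g)
  set x : Fin m → ℂ := fun i => ∑ g ∈ D i, (χ g : ℂ) with hxdef
  have heq (j : Fin m) : (∑ i, x i) * conj (x j) = x j * conj (x j) - (lam : ℝ) := by
    rw [Complex.ofReal_natCast]
    exact h.sum_character_mul_conj hχ j
  have hX' : ∑ i, x i ≠ 0 := hX
  let o : Fin m := ⟨0, by omega⟩
  have hdich (j : Fin m) : x j = x o ∨ x o + x j = ∑ i, x i :=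
    eq_or_add_eq_of_mul_conj_eq hX' (heq o) (heq j)
  obtain ⟨j, hj⟩ : ∃ j, x j ≠ x o := by
    by_contra! hcon
    have h1 := heq o
    simp only [hcon, Finset.sum_const, Finset.card_univ, Fintype.card_fin, nsmul_eq_mul,
      mul_assoc, Complex.mul_conj] at h1
    have h2 : (m : ℝ) * Complex.normSq (x o) = Complex.normSq (x o) - lam := by exact_mod_cast h1
    have h3 : (3 : ℝ) ≤ m := by exact_mod_cast hm
    have h4 : (0 : ℝ) < lam := by exact_mod_cast hlam
    nlinarith [Complex.normSq_nonneg (x o)]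
  have hXj : x o + x j = ∑ i, x i := (hdich j).resolve_left hj
  classical
  set n := (Finset.univ.filter fun i => x i = x o).card with hn
  set n' := (Finset.univ.filter fun i => ¬ x i = x o).card with hn'
  have hnn : n + n' = m := by
    simpa using Finset.card_filter_add_card_filter_not (s := Finset.univ) fun i => x i = x o
  have hlin : ((n : ℂ) - 1) * x o + ((n' : ℂ) - 1) * x j = 0 := by
    have h1 : ∑ i, x i = n * x o + n' * x j := by
      rw [← Finset.sum_filter_add_sum_filter_not Finset.univ fun i => x i = x o,
        Finset.sum_eq_card_nsmul fun i hi => (Finset.mem_filter.mp hi).2,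
        Finset.sum_eq_card_nsmul (b := x j) fun i hi => ?_, nsmul_eq_mul, nsmul_eq_mul]
      have := (hdich i).resolve_left (Finset.mem_filter.mp hi).2
      exact add_left_cancel (this.trans hXj.symm)
    linear_combination -h1 - hXj
  have hdvd := dvd_sum_of_sum_mul_rootsOfUnity_eq_zero (ι := G) Finset.univ hp
    (fun g => ((n : ℤ) - 1) * (if g ∈ D o then 1 else 0)
      + ((n' : ℤ) - 1) * (if g ∈ D j then 1 else 0)) (fun g => (χ g : ℂ)) hroot (by
    rw [← hlin]
    simp [hxdef, add_mul, Finset.sum_add_distrib, Finset.mul_sum])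
  rw [Finset.sum_add_distrib, ← Finset.mul_sum, ← Finset.mul_sum] at hdvd
  simp only [Finset.sum_ite_mem, Finset.univ_inter, Finset.sum_const, hcard, nsmul_eq_mul,
    mul_one] at hdvd
  rw [← Int.natCast_dvd_natCast]
  convert hdvd using 1
  rw [Nat.cast_mul, Nat.cast_sub (by omega), ← hnn]
  push_cast
  ring
end

section
/- Let {D_1,...,D_m} be a (v,m,k,λ)-SEDF in a finite abelian group G with m ≥ 3 and set D = D_1 ∪ ... ∪ D_m. Let p > 2 be a prime divisor of v with p not dividing λ, and let χ be a nonprincipal character of G of order p^a. Let q be a prime divisor of λ with q^b | λ such that q is self-conjugate modulo p^a, and suppose λ is not a perfect square. Then: (i) if χ(D) = 0, then p ≤ N² + N + 1 where N = λ/q^{2⌊(b+1)/2⌋}; (ii) if χ(D) ≠ 0, let a_χ < b_χ be the coprime positive integers with 1 + 4λ/|χ(D)|² = (b_χ/a_χ)², and suppose 4λ/(b_χ²−a_χ²) is not a perfect square; then p ≤ M² + M + 1, where M = λ/(b_χ²−a_χ²) if gcd(a_χ+b_χ, 2a_χ) = 1 and M = 4λ/(b_χ²−a_χ²) if gcd(a_χ+b_χ,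 2a_χ) = 2. -/
/-- If `0` is a most frequent value of `f` on `F`, and the squared differences of `f` over the pairs
in `F` add up to at most `2 * N * (#F - 1)`, then `f` has few nonzero values on `F`. -/
lemma card_ne_zero_bound_of_sum_sq_sub {ι : Type*} [DecidableEq ι] (F : Finset ι) (f : ι → ℤ)
    (N : ℤ) (hN : 0 < N) (hF : N ^ 2 + N + 1 < F.card)
    (hmode : ∀ z : ℤ, (F.filter (fun i => f i = z)).card ≤ (F.filter (fun i => f i = 0)).card)
    (hsum : ∑ i ∈ F, ∑ j ∈ F, (f i - f j) ^ 2 ≤ 2 * N * (F.card - 1)) :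
    ((F.filter (fun i => f i ≠ 0)).card : ℤ) ≤ N ∧
    2 * ((F.filter (fun i => f i ≠ 0)).card : ℤ) *
      (F.card - (F.filter (fun i => f i ≠ 0)).card) ≤ ∑ i ∈ F, ∑ j ∈ F, (f i - f j) ^ 2 := by
  set w : ℤ := ((F.filter (fun i => f i ≠ 0)).card : ℤ) with hw
  set p : ℤ := (F.card : ℤ) with hp
  have hzero : ((F.filter (fun i => f i = 0)).card : ℤ) = p - w := by
    have := Finset.card_filter_add_card_filter_not (s := F) (fun i => f i = 0)
    simp only [hw, hp, ne_eq]
    omega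
  have hw0 : 0 ≤ w := by positivity
  have hpw : w ≤ p := by
    have : 0 ≤ ((F.filter (fun i => f i = 0)).card : ℤ) := by positivity
    omega
  have hrow : ∀ i ∈ F, w ≤ ∑ j ∈ F, (f i - f j) ^ 2 := by
    intro i _
    have h1 : ((F.filter (fun j => f j ≠ f i)).card : ℤ) ≤ ∑ j ∈ F, (f i - f j) ^ 2 := by
      rw [Finset.card_filter]
      push_cast
      refine Finset.sum_le_sum fun j _ => ?_
      split_ifs with h
      · have : f i - f j ≠ 0 := fun h' => h (by omega)
        have := sq_pos_of_ne_zero this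
        omega
      · positivity
    have h2 := Finset.card_filter_add_card_filter_not (s := F) (fun j => f j = f i)
    have h3 := hmode (f i)
    simp only [ne_eq] at h1
    omega
  have hrow0 : ∀ i ∈ F.filter (fun i => f i ≠ 0), p - w ≤
      ∑ j ∈ F.filter (fun i => f i = 0), (f i - f j) ^ 2 := by
    intro i hi
    rw [← hzero, Finset.card_eq_sum_ones]
    push_cast
    refine Finset.sum_le_sum fun j hj => ?_
    rw [Finset.mem_filter] at hi hj
    rw [hj.2, sub_zero]
    have := sq_pos_of_ne_zero hi.2
    omega
  have hA : w * (p - w) ≤ ∑ i ∈ F.filter (fun i => f i ≠ 0),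
      ∑ j ∈ F.filter (fun i => f i = 0), (f i - f j) ^ 2 := by
    have := Finset.card_nsmul_le_sum _ _ _ hrow0
    simpa [hw] using this
  have hB : ∑ i ∈ F.filter (fun i => f i = 0),
      ∑ j ∈ F.filter (fun i => f i ≠ 0), (f i - f j) ^ 2 =
      ∑ i ∈ F.filter (fun i => f i ≠ 0),
      ∑ j ∈ F.filter (fun i => f i = 0), (f i - f j) ^ 2 := by
    rw [Finset.sum_comm]
    exact Finset.sum_congr rfl fun i _ => Finset.sum_congr rfl fun j _ => by ring
  have hC : 2 * w * (p - w) ≤ ∑ i ∈ F, ∑ j ∈ F, (f i - f j) ^ 2 := by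
    rw [← Finset.sum_filter_add_sum_filter_not F (fun i => f i = 0)]
    have h1 : ∑ i ∈ F.filter (fun i => f i = 0), ∑ j ∈ F.filter (fun i => f i ≠ 0),
        (f i - f j) ^ 2 ≤ ∑ i ∈ F.filter (fun i => f i = 0), ∑ j ∈ F, (f i - f j) ^ 2 :=
      Finset.sum_le_sum fun i _ => Finset.sum_le_sum_of_subset_of_nonneg
        (Finset.filter_subset _ _) fun j _ _ => sq_nonneg _
    have h2 : ∑ i ∈ F.filter (fun i => f i ≠ 0), ∑ j ∈ F.filter (fun i => f i = 0),
        (f i - f j) ^ 2 ≤ ∑ i ∈ F.filter (fun i => ¬ f i = 0), ∑ j ∈ F, (f i - f j) ^ 2 :=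
      Finset.sum_le_sum fun i _ => Finset.sum_le_sum_of_subset_of_nonneg
        (Finset.filter_subset _ _) fun j _ _ => sq_nonneg _
    linarith
  refine ⟨?_, hC⟩
  have hD : p * w ≤ 2 * N * (p - 1) := by
    have := Finset.card_nsmul_le_sum _ _ _ hrow
    rw [nsmul_eq_mul] at this
    linarith
  have hw2 : w < 2 * N := by nlinarith
  by_contra! hlt
  nlinarith [mul_nonneg (show 0 ≤ w - N - 1 by omega)
    (show 0 ≤ p - w - N - 1 by nlinarith [sq_nonneg (N - 1)])]

/-- If the autocorrelation of `f` is, up to the value `N` at `0`, periodic under a subgroup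
with more than `N ^ 2 + N + 1` elements, and `0` is a most frequent value of `f` on every coset,
then `N` is a square. -/
lemma isSquare_of_autocorrelation_periodic {K : Type*} [AddCommGroup K] [Fintype K] [DecidableEq K]
    (P : AddSubgroup K) [DecidableEq (K ⧸ P)] (f : K → ℤ) (N : ℕ) (hN : 0 < N)
    (hP : N ^ 2 + N + 1 < Nat.card P)
    (hmode : ∀ (x : K ⧸ P) (z : ℤ),
      (Finset.univ.filter (fun i : K => (i : K ⧸ P) = x ∧ f i = z)).card ≤
        (Finset.univ.filter (fun i : K => (i : K ⧸ P) = x ∧ f i = 0)).card)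
    (hper : ∀ g, ∀ u ∈ P, (∑ i, f (i + (g + u)) * f i) - (if g + u = 0 then (N : ℤ) else 0) =
      (∑ i, f (i + g) * f i) - (if g = 0 then (N : ℤ) else 0)) :
    IsSquare N := by
  classical
  set p := Nat.card P with hp
  set c : K → ℤ := fun g => ∑ i, f (i + g) * f i with hc
  have hcP : ∀ u ∈ P, u ≠ 0 → c u = c 0 - N := by
    intro u hu hu0
    have := hper 0 u hu
    simpa [hu0, hc] using this
  let fib : K ⧸ P → Finset K := fun x => Finset.univ.filter (fun i : K => (i : K ⧸ P) = x)
  have hfib : ∀ (i : K) (φ : K → ℤ), ∑ j ∈ fib (i : K ⧸ P), φ j = ∑ u : P, φ (i + u) := by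
    intro i φ
    symm
    refine Finset.sum_bij (fun u _ => i + (u : K)) ?_ ?_ ?_ ?_
    · intro u _
      simp only [fib, Finset.mem_filter, Finset.mem_univ, true_and]
      rw [eq_comm, QuotientAddGroup.eq]
      simp
    · intro u _ u' _ h
      exact Subtype.ext (add_left_cancel h)
    · intro j hj
      simp only [fib, Finset.mem_filter, Finset.mem_univ, true_and] at hj
      rw [eq_comm, QuotientAddGroup.eq] at hj
      exact ⟨⟨_, hj⟩, Finset.mem_univ _, by simp⟩
    · intros; rfl
  have hfibcard : ∀ x, ((fib x).card : ℤ) = p := by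
    intro x
    obtain ⟨i, rfl⟩ := QuotientAddGroup.mk_surjective x
    have := hfib i (fun _ => 1)
    simpa [hp] using this
  have hpos : 0 < p := by omega
  -- the total of the squared differences over all cosets
  have hdiff : ∀ u : K, ∑ i, (f i - f (i + u)) ^ 2 = 2 * c 0 - 2 * c u := by
    intro u
    have h1 : ∑ i, f (i + u) ^ 2 = ∑ i, f i ^ 2 :=
      Fintype.sum_equiv (Equiv.addRight u) _ _ fun i => rfl
    have h2 : c 0 = ∑ i, f i ^ 2 := by simp [hc, sq]
    have h3 : ∀ i, (f i - f (i + u)) ^ 2 = f i ^ 2 + f (i + u) ^ 2 - 2 * (f (i + u) * f i) :=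
      fun i => by ring
    simp_rw [h3]
    rw [Finset.sum_sub_distrib, Finset.sum_add_distrib, h1, ← h2, ← Finset.mul_sum]
    ring
  have htot : ∑ x, ∑ i ∈ fib x, ∑ j ∈ fib x, (f i - f j) ^ 2 = 2 * N * ((p : ℤ) - 1) := by
    have h1 : ∑ x, ∑ i ∈ fib x, ∑ j ∈ fib x, (f i - f j) ^ 2 =
        ∑ x, ∑ i ∈ fib x, ∑ u : P, (f i - f (i + u)) ^ 2 := by
      refine Finset.sum_congr rfl fun x _ => Finset.sum_congr rfl fun i hi => ?_
      have hx : (i : K ⧸ P) = x := by simpa [fib] using hi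
      rw [← hx, hfib]
    rw [h1]
    rw [Finset.sum_fiberwise Finset.univ (fun i : K => (i : K ⧸ P))
      (fun i => ∑ u : P, (f i - f (i + u)) ^ 2), Finset.sum_comm]
    simp_rw [hdiff]
    rw [← Finset.add_sum_erase _ _ (Finset.mem_univ (0 : P))]
    have h2 : ∀ u ∈ Finset.univ.erase (0 : P), 2 * c 0 - 2 * c (u : K) = 2 * N := by
      intro u hu
      rw [hcP u u.2 (by simpa using hu)]
      ring
    rw [Finset.sum_congr rfl h2, Finset.sum_const, Finset.card_erase_of_mem (Finset.mem_univ _),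
      Finset.card_univ, ← Nat.card_eq_fintype_card, ← hp]
    simp [Nat.cast_sub (show 1 ≤ p from hpos)]
    ring
  have hnn : ∀ x, 0 ≤ ∑ i ∈ fib x, ∑ j ∈ fib x, (f i - f j) ^ 2 :=
    fun x => Finset.sum_nonneg fun i _ => Finset.sum_nonneg fun j _ => sq_nonneg _
  have hone : ∀ x, ∑ i ∈ fib x, ∑ j ∈ fib x, (f i - f j) ^ 2 ≤ 2 * N * ((p : ℤ) - 1) :=
    fun x => htot ▸ Finset.single_le_sum (fun y _ => hnn y) (Finset.mem_univ x)
  have hPZ : (N : ℤ) ^ 2 + N + 1 < p := by exact_mod_cast hP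
  have hlocal : ∀ x, _ := fun x => card_ne_zero_bound_of_sum_sq_sub (fib x) f N
    (by exact_mod_cast hN)
    (by rw [hfibcard]; exact hPZ)
    (fun z => by simpa [fib, Finset.filter_filter] using hmode x z)
    (by rw [hfibcard]; exact hone x)
  set W := (Finset.univ.filter (fun i => f i ≠ 0)).card with hW
  have hWsum : (W : ℤ) = ∑ x, (((fib x).filter (fun i => f i ≠ 0)).card : ℤ) := by
    rw [hW, Finset.card_eq_sum_card_fiberwise (f := fun i : K => (i : K ⧸ P)) (t := Finset.univ)
      (fun _ _ => by simp)]
    push_cast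
    refine Finset.sum_congr rfl fun x _ => ?_
    simp only [fib, Finset.filter_filter, and_comm]
  have hWN : W ≤ N := by
    have h1 : 2 * (W : ℤ) * (p - N) ≤ 2 * N * ((p : ℤ) - 1) := by
      rw [← htot, hWsum, Finset.mul_sum, Finset.sum_mul]
      refine Finset.sum_le_sum fun x _ => ?_
      obtain ⟨h2, h3⟩ := hlocal x
      rw [hfibcard] at h3
      refine le_trans ?_ h3
      exact mul_le_mul_of_nonneg_left (by linarith) (by positivity)
    by_contra! hlt
    have hlt' : (N : ℤ) + 1 ≤ W := by exact_mod_cast hlt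
    nlinarith [mul_nonneg (sub_nonneg.2 hlt') (show (0 : ℤ) ≤ p - N by nlinarith)]
  have hczero : ∀ g, g ≠ 0 → c g = 0 := by
    intro g hg
    by_contra hcg
    let S := Finset.univ.filter (fun i => f i ≠ 0)
    let U : Finset K := (Finset.univ.image (fun u : P => g + (u : K))).erase 0
    have hUcard : p - 1 ≤ U.card := by
      have : (Finset.univ.image (fun u : P => g + (u : K))).card = p := by
        rw [Finset.card_image_of_injective _ fun u u' h => Subtype.ext (add_left_cancel h),
          Finset.card_univ, ← Nat.card_eq_fintype_card]
      rw [← this]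
      exact Finset.pred_card_le_card_erase
    have hUsub : U ⊆ (S ×ˢ S).image (fun x => x.1 - x.2) := by
      intro y hy
      simp only [U, Finset.mem_erase, Finset.mem_image, Finset.mem_univ, true_and] at hy
      obtain ⟨hy0, u, rfl⟩ := hy
      have h1 := hper g u u.2
      simp only [hg, hy0, if_false, sub_zero] at h1
      have h2 : ∑ i, f (i + (g + u)) * f i ≠ 0 := by rw [h1]; exact hcg
      obtain ⟨i, -, hi⟩ := Finset.exists_ne_zero_of_sum_ne_zero h2
      refine Finset.mem_image.2 ⟨(i + (g + u), i), ?_, by simp⟩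
      simp only [S, Finset.mem_product, Finset.mem_filter, Finset.mem_univ, true_and]
      exact ⟨left_ne_zero_of_mul hi, right_ne_zero_of_mul hi⟩
    have h3 := (Finset.card_le_card hUsub).trans Finset.card_image_le
    rw [Finset.card_product] at h3
    have h4 : S.card = W := rfl
    have h5 : W * W ≤ N * N := Nat.mul_le_mul hWN hWN
    rw [h4] at h3
    nlinarith [Nat.sub_add_cancel (show 1 ≤ p from hpos)]
  have hc0 : c 0 = N := by
    have : 1 < Nat.card P := by omega
    have : Nontrivial P := (Finite.one_lt_card_iff_nontrivial).1 this
    obtain ⟨u, hu⟩ := exists_ne (0 : P)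
    have hu' : (u : K) ≠ 0 := by simpa using hu
    have h1 := hcP u u.2 hu'
    rw [hczero u hu'] at h1
    omega
  have hsq : (∑ i, f i) * (∑ i, f i) = ∑ g, c g := by
    simp only [hc]
    rw [Finset.sum_comm, Finset.sum_mul_sum, Finset.sum_comm]
    refine Finset.sum_congr rfl fun i _ => ?_
    exact (Fintype.sum_equiv (Equiv.addLeft i) _ _ fun g => rfl).symm
  rw [Finset.sum_eq_single 0 (fun g _ hg => hczero g hg) (by simp), hc0] at hsq
  refine ⟨(∑ i, f i).natAbs, ?_⟩
  rw [← Int.natAbs_mul, hsq]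
  simp

/-- Evaluation of an element of the integral group ring of `ZMod n` at a character. -/
noncomputable def AddChar.groupRingEval {n : ℕ} (e : AddChar (ZMod n) ℂ) :
    AddMonoidAlgebra ℤ (ZMod n) →ₐ[ℤ] ℂ :=
  AddMonoidAlgebra.lift ℤ ℂ (ZMod n) e.toMonoidHom

namespace AddChar

lemma apply_mem_range_groupRingEval {n : ℕ} (e : AddChar (ZMod n) ℂ) (i : ZMod n) :
    e i ∈ e.groupRingEval.range :=
  ⟨.single i 1, by
    change e.groupRingEval _ = _
    simp [groupRingEval, AddMonoidAlgebra.lift_single]⟩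

variable {n : ℕ} [NeZero n] (e : AddChar (ZMod n) ℂ)

lemma groupRingEval_apply (A : AddMonoidAlgebra ℤ (ZMod n)) :
    e.groupRingEval A = ∑ i, (A.coeff i : ℂ) * e i := by
  rw [groupRingEval, AddMonoidAlgebra.lift_apply, Finsupp.sum_fintype _ _ (by simp)]
  simp

lemma mem_range_groupRingEval {x : ℂ} :
    x ∈ e.groupRingEval.range ↔ ∃ f : ZMod n → ℤ, x = ∑ i, (f i : ℂ) * e i := by
  constructor
  · rintro ⟨A, rfl⟩
    exact ⟨A.coeff, e.groupRingEval_apply A⟩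
  · rintro ⟨f, rfl⟩
    exact ⟨.ofCoeff (Finsupp.equivFunOnFinite.symm f), by
      change e.groupRingEval _ = _
      simp [groupRingEval_apply]⟩

lemma conj_mem_range_groupRingEval {x : ℂ} (hx : x ∈ e.groupRingEval.range) :
    starRingEnd ℂ x ∈ e.groupRingEval.range := by
  rw [mem_range_groupRingEval] at hx
  obtain ⟨f, rfl⟩ := hx
  rw [map_sum]
  refine Subalgebra.sum_mem _ fun i _ => ?_
  rw [map_mul, ← e.map_neg_eq_conj]
  refine Subalgebra.mul_mem _ ?_ (e.apply_mem_range_groupRingEval _)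
  simp

lemma isIntegral_of_mem_range_groupRingEval {x : ℂ} (hx : x ∈ e.groupRingEval.range) :
    IsIntegral ℤ x := by
  rw [mem_range_groupRingEval] at hx
  obtain ⟨f, rfl⟩ := hx
  refine IsIntegral.sum _ fun i _ => IsIntegral.mul (isIntegral_algebraMap (x := f i)) ?_
  refine IsIntegral.of_pow (NeZero.pos n) ?_
  rw [← e.map_nsmul_eq_pow]
  simp [isIntegral_one]

/-- The squared absolute value of a cyclotomic integer is a natural number if it is rational. -/
lemma exists_normSq_eq_natCast {x : ℂ} (hx : x ∈ e.groupRingEval.range) (r : ℚ)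
    (hr : Complex.normSq x = r) : ∃ N : ℕ, (N : ℚ) = r := by
  have h1 : IsIntegral ℤ (x * starRingEnd ℂ x) :=
    (e.isIntegral_of_mem_range_groupRingEval hx).mul
      (e.isIntegral_of_mem_range_groupRingEval (e.conj_mem_range_groupRingEval hx))
  rw [Complex.mul_conj, hr] at h1
  have h2 : IsIntegral ℤ r := by
    refine (isIntegral_algebraMap_iff (B := ℂ) (algebraMap ℚ ℂ).injective).1 ?_
    simpa using h1
  obtain ⟨y, hy⟩ := IsIntegrallyClosed.isIntegral_iff.1 h2
  have h3 : (0 : ℚ) ≤ r := by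
    have := Complex.normSq_nonneg x
    rw [hr] at this
    exact_mod_cast this
  have h4 : (0 : ℤ) ≤ y := by
    rw [← hy] at h3
    simpa using h3
  refine ⟨y.toNat, ?_⟩
  rw [← hy, ← Int.cast_natCast, Int.toNat_of_nonneg h4]
  simp

end AddChar

/-- The integral relations between the `p ^ (k + 1)`-th roots of unity are periodic. -/
lemma coeff_add_eq_of_sum_eq_zero {n p k : ℕ} [Fact p.Prime] [NeZero n] (hn : n = p ^ (k + 1))
    {ζ : ℂ} (hζ : IsPrimitiveRoot ζ n) (f : ZMod n → ℤ)
    (hf : ∑ i, (f i : ℂ) * AddChar.zmodChar _ hζ.pow_eq_one i = 0) (g : ZMod n) :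
    f (g + ((p ^ k : ℕ) : ZMod n)) = f g := by
  let C : Polynomial ℤ := ∑ i : ZMod n, Polynomial.C (f i) * Polynomial.X ^ i.val
  have hC : Polynomial.aeval ζ C = 0 := by
    rw [← hf]
    simp [C, AddChar.zmodChar_apply]
  have hdvd : Polynomial.cyclotomic n ℤ ∣ C := by
    rw [Polynomial.cyclotomic_eq_minpoly hζ (NeZero.pos n)]
    exact minpoly.isIntegrallyClosed_dvd (hζ.isIntegral (NeZero.pos n)) hC
  obtain ⟨Q, hQ⟩ := hdvd
  have hQ' : C * (Polynomial.X ^ p ^ k - 1) = (Polynomial.X ^ n - 1) * Q := by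
    rw [hQ, hn, ← Polynomial.cyclotomic_prime_pow_mul_X_pow_sub_one ℤ p k]
    ring
  let A : AddMonoidAlgebra ℤ (ZMod n) := .ofCoeff (Finsupp.equivFunOnFinite.symm f)
  have hpow : ∀ m : ℕ, (AddMonoidAlgebra.single (1 : ZMod n) (1 : ℤ)) ^ m =
      AddMonoidAlgebra.single (m : ZMod n) (1 : ℤ) := by
    intro m
    rw [AddMonoidAlgebra.single_pow]
    simp
  have hA : Polynomial.aeval (AddMonoidAlgebra.single (1 : ZMod n) (1 : ℤ)) C = A := by
    simp only [C, map_sum, map_mul, map_pow, Polynomial.aeval_C, Polynomial.aeval_X, hpow]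
    ext i
    simp [A, AddMonoidAlgebra.coeff_sum, Finsupp.single_apply, ← zsmul_eq_mul]
  have h := congrArg (Polynomial.aeval (AddMonoidAlgebra.single (1 : ZMod n) (1 : ℤ))) hQ'
  rw [map_mul, hA, map_mul, map_sub, map_sub, map_pow, map_pow, Polynomial.aeval_X, hpow, hpow,
    map_one, CharP.cast_eq_zero (ZMod n) n, ← AddMonoidAlgebra.one_def, sub_self, zero_mul,
    mul_sub, mul_one, sub_eq_zero] at h
  have h2 := congrArg (fun B => AddMonoidAlgebra.coeff B (g + ((p ^ k : ℕ) : ZMod n))) h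
  beta_reduce at h2
  rw [AddMonoidAlgebra.coeff_mul_single_eq_coeff_mul g (by simp)] at h2
  simpa [A] using h2.symm

/-- If the squared absolute value of an element of `ℤ[ζ]`, `ζ` a root of unity of order `p ^ a`,
is a nonsquare natural number `N`, then `p ≤ N ^ 2 + N + 1`. -/
lemma prime_le_of_normSq_eq {n p k : ℕ} [Fact p.Prime] [NeZero n] (hn : n = p ^ (k + 1)) {ζ : ℂ}
    (hζ : IsPrimitiveRoot ζ n) {x : ℂ}
    (hx : x ∈ (AddChar.zmodChar _ hζ.pow_eq_one).groupRingEval.range) (N : ℕ)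
    (hN : Complex.normSq x = N) (hsq : ¬ IsSquare N) : p ≤ N ^ 2 + N + 1 := by
  classical
  by_contra! hlt
  apply hsq
  set e := AddChar.zmodChar n hζ.pow_eq_one with he
  obtain ⟨f, rfl⟩ := e.mem_range_groupRingEval.1 hx
  let u₀ : ZMod n := ((p ^ k : ℕ) : ZMod n)
  let P := AddSubgroup.zmultiples u₀
  have hp : p.Prime := Fact.out
  have hcard : Nat.card P = p := by
    rw [Nat.card_zmultiples, ZMod.addOrderOf_coe _ (NeZero.ne n), hn,
      Nat.gcd_eq_right (pow_dvd_pow p (Nat.le_succ k)), pow_succ,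
      Nat.mul_div_cancel_left _ (pow_pos hp.pos k)]
  have hexists : ∀ y : ZMod n ⧸ P, ∃ z : ℤ, ∀ z' : ℤ,
      (Finset.univ.filter (fun i : ZMod n => (i : ZMod n ⧸ P) = y ∧ f i = z')).card ≤
      (Finset.univ.filter (fun i : ZMod n => (i : ZMod n ⧸ P) = y ∧ f i = z)).card := by
    intro y
    let φ : ℤ → ℕ := fun z =>
      (Finset.univ.filter (fun i : ZMod n => (i : ZMod n ⧸ P) = y ∧ f i = z)).card
    have hb : BddAbove (Set.range φ) :=
      ⟨Fintype.card (ZMod n), by rintro _ ⟨z, rfl⟩; exact Finset.card_le_univ _⟩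
    obtain ⟨z, hz⟩ := Nat.sSup_mem (Set.range_nonempty φ) hb
    exact ⟨z, fun z' => (le_csSup hb ⟨z', rfl⟩).trans_eq hz.symm⟩
  choose s hs using hexists
  let f' : ZMod n → ℤ := fun i => f i - s (i : ZMod n ⧸ P)
  have hu₀ : e u₀ ≠ 1 := by
    rw [he, AddChar.zmodChar_apply']
    exact hζ.pow_ne_one_of_pos_of_lt (pow_pos hp.pos k).ne'
      (hn ▸ Nat.pow_lt_pow_right hp.one_lt k.lt_succ_self)
  have hzero : ∑ i : ZMod n, (s (i : ZMod n ⧸ P) : ℂ) * e i = 0 := by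
    have h1 : ∑ i : ZMod n, (s (i : ZMod n ⧸ P) : ℂ) * e i =
        e u₀ * ∑ i : ZMod n, (s (i : ZMod n ⧸ P) : ℂ) * e i := by
      conv_lhs => rw [← Equiv.sum_comp (Equiv.addRight u₀)]
      rw [Finset.mul_sum]
      refine Finset.sum_congr rfl fun i _ => ?_
      have : ((i + u₀ : ZMod n) : ZMod n ⧸ P) = (i : ZMod n ⧸ P) := by
        rw [eq_comm, QuotientAddGroup.eq]
        simp [P]
      simp only [Equiv.coe_addRight, this, AddChar.map_add_eq_mul]
      ring
    have h2 : (e u₀ - 1) * ∑ i : ZMod n, (s (i : ZMod n ⧸ P) : ℂ) * e i = 0 := by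
      rw [sub_mul, one_mul, ← h1, sub_self]
    exact (mul_eq_zero.1 h2).resolve_left (sub_ne_zero.2 hu₀)
  have hf' : ∑ i, (f i : ℂ) * e i = ∑ i, (f' i : ℂ) * e i := by
    simp only [f', Int.cast_sub, sub_mul, Finset.sum_sub_distrib, hzero, sub_zero]
  rw [hf'] at hN
  let c : ZMod n → ℤ := fun g => ∑ i, f' (i + g) * f' i
  have hc : ∑ g, (c g : ℂ) * e g = N := by
    have h1 : (∑ i, (f' i : ℂ) * e i) * starRingEnd ℂ (∑ i, (f' i : ℂ) * e i) = N := by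
      rw [Complex.mul_conj, hN]
      simp
    rw [← h1, map_sum, Finset.sum_mul_sum, Finset.sum_comm]
    simp only [c, Int.cast_sum, Finset.sum_mul]
    rw [Finset.sum_comm]
    refine Finset.sum_congr rfl fun i _ => ?_
    refine Fintype.sum_equiv (Equiv.addLeft i) _ _ fun g => ?_
    have h2 : e i * starRingEnd ℂ (e i) = 1 := by
      rw [← e.map_neg_eq_conj, ← AddChar.map_add_eq_mul]
      simp
    simp only [Equiv.coe_addLeft, AddChar.map_add_eq_mul, map_mul, map_intCast, Int.cast_mul]
    linear_combination -(f' (i + g) * f' i * e g : ℂ) * h2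
  let d : ZMod n → ℤ := fun g => c g - if g = 0 then (N : ℤ) else 0
  have hd : ∑ g, (d g : ℂ) * e g = 0 := by
    simp only [d, Int.cast_sub, sub_mul, Finset.sum_sub_distrib, hc]
    simp [ite_mul]
  have hper : ∀ g, d (g + u₀) = d g := coeff_add_eq_of_sum_eq_zero hn hζ d hd
  refine isSquare_of_autocorrelation_periodic P f' N ?_ (hcard ▸ hlt) ?_ ?_
  · rcases Nat.eq_zero_or_pos N with h | h
    · exact absurd (h ▸ IsSquare.zero) hsq
    · exact h
  · intro y z
    have h1 : ∀ z, Finset.univ.filter (fun i : ZMod n => (i : ZMod n ⧸ P) = y ∧ f' i = z) =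
        Finset.univ.filter (fun i : ZMod n => (i : ZMod n ⧸ P) = y ∧ f i = z + s y) := by
      intro z
      ext i
      simp only [f', Finset.mem_filter, Finset.mem_univ, true_and]
      constructor
      · rintro ⟨rfl, h⟩
        exact ⟨rfl, by omega⟩
      · rintro ⟨rfl, h⟩
        exact ⟨rfl, by omega⟩
    rw [h1, h1, zero_add]
    exact hs y _
  · intro g u hu
    have : Function.Periodic d u := by
      obtain ⟨m, rfl⟩ := AddSubgroup.mem_zmultiples_iff.1 hu
      exact Function.Periodic.zsmul hper m
    exact this g

namespace AddChar

variable {n : ℕ} [NeZero n] (e : AddChar (ZMod n) ℂ)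

/-- The `q ^ r`-th power map acts on `ℤ[ζ]` modulo `q` by `ζ ↦ ζ ^ (q ^ r)`. -/
lemma dvd_pow_sub_groupRingEval {q : ℕ} [Fact q.Prime] (r : ℕ) (f : ZMod n → ℤ)
    (x y : e.groupRingEval.range) (hx : (x : ℂ) = ∑ i, (f i : ℂ) * e i)
    (hy : (y : ℂ) = ∑ i, (f i : ℂ) * e (((q ^ r : ℕ) : ZMod n) * i)) :
    (q : e.groupRingEval.range) ∣ x ^ q ^ r - y := by
  let R := e.groupRingEval.range
  by_cases hu : (q : R) ∈ nonunits R
  swap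
  · exact (not_not.1 hu).dvd
  have := CharP.quotient R q hu
  let I : Ideal R := Ideal.span {(q : R)}
  let E : ZMod n → R := fun i => ⟨e i, e.apply_mem_range_groupRingEval i⟩
  have hx' : x = ∑ i, (f i : R) * E i := by
    apply Subtype.ext
    rw [hx]
    simp [E]
  have hy' : y = ∑ i, (f i : R) * E i ^ q ^ r := by
    apply Subtype.ext
    rw [hy]
    simp [E, ← AddChar.map_nsmul_eq_pow, nsmul_eq_mul]
  have hfix : ∀ z : ℤ, (z : R ⧸ I) ^ q ^ r = z := by
    intro z
    have h1 := congrArg (ZMod.castHom (dvd_refl q) (R ⧸ I))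
      (ZMod.pow_card_pow (n := r) (z : ZMod q))
    rwa [map_pow, map_intCast] at h1
  rw [← Ideal.mem_span_singleton]
  refine (Ideal.Quotient.eq (I := I)).1 ?_
  rw [map_pow, hx', hy', map_sum, map_sum, sum_pow_char_pow]
  refine Finset.sum_congr rfl fun i _ => ?_
  rw [map_mul, map_mul, mul_pow, map_pow, map_intCast, hfix]

/-- If `q` is self-conjugate modulo `n` and divides `|x| ^ 2`, then `q` divides `x`. -/
lemma exists_eq_mul_of_dvd_normSq (hn : 2 < n) {q : ℕ} (hq : q.Prime) {r : ℕ}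
    (hr : (q : ZMod n) ^ r = -1)
    {x : ℂ} (hx : x ∈ e.groupRingEval.range) {M : ℕ} (hM : Complex.normSq x = M) (hqM : q ∣ M) :
    ∃ y ∈ e.groupRingEval.range, x = q * y := by
  have : Fact q.Prime := ⟨hq⟩
  let R := e.groupRingEval.range
  let X : R := ⟨x, hx⟩
  let X' : R := ⟨starRingEnd ℂ x, e.conj_mem_range_groupRingEval hx⟩
  have hXX : X * X' = (M : R) := by
    apply Subtype.ext
    simp [X, X', Complex.mul_conj, hM]
  obtain ⟨f, hf⟩ := e.mem_range_groupRingEval.1 hx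
  have h1 : (q : R) ∣ X ^ q ^ r - X' := by
    refine e.dvd_pow_sub_groupRingEval r f X X' hf ?_
    simp [X', hf, hr, AddChar.map_neg_eq_conj]
  have h2 : (q : R) ∣ X ^ q ^ (2 * r) - X := by
    refine e.dvd_pow_sub_groupRingEval (2 * r) f X X hf ?_
    simp [X, hf, pow_mul', hr]
  have h3 : (q : R) ∣ X ^ (q ^ r + 1) := by
    have h4 : (q : R) ∣ X * X' := hXX ▸ Nat.cast_dvd_cast hqM
    have h5 : X ^ (q ^ r + 1) = X * (X ^ q ^ r - X') + X * X' := by ring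
    rw [h5]
    exact dvd_add (h1.mul_left X) h4
  have h6 : (q : R) ∣ X := by
    have hr0 : r ≠ 0 := by
      rintro rfl
      have h7 : ((2 : ℕ) : ZMod n) = 0 := by
        rw [pow_zero] at hr
        push_cast
        linear_combination hr
      exact absurd (Nat.le_of_dvd two_pos ((ZMod.natCast_eq_zero_iff _ _).1 h7)) (by omega)
    have h7 : q ^ r + 1 ≤ q ^ (2 * r) := Nat.pow_lt_pow_right hq.one_lt (by omega)
    have h8 := dvd_sub (h3.trans (pow_dvd_pow X h7)) h2
    rwa [sub_sub_cancel] at h8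
  obtain ⟨Y, hY⟩ := h6
  exact ⟨Y, Y.2, by simpa [X] using congrArg Subtype.val hY⟩

/-- If `q` is self-conjugate modulo `n` and `q ^ b` divides `|x| ^ 2`, then `q ^ ⌈b / 2⌉`
divides `x`. -/
lemma exists_eq_pow_mul_of_pow_dvd_normSq (hn : 2 < n) {q : ℕ} (hq : q.Prime) {r : ℕ}
    (hr : (q : ZMod n) ^ r = -1) (b : ℕ) {x : ℂ} (hx : x ∈ e.groupRingEval.range) {M : ℕ}
    (hM : Complex.normSq x = M) (hqM : q ^ b ∣ M) :
    ∃ y ∈ e.groupRingEval.range, x = q ^ ((b + 1) / 2) * y := by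
  induction b using Nat.strong_induction_on generalizing x M with
  | _ b ih =>
    rcases Nat.eq_zero_or_pos b with rfl | hb
    · exact ⟨x, hx, by simp⟩
    obtain ⟨y, hy, rfl⟩ := e.exists_eq_mul_of_dvd_normSq hn hq hr hx hM
      ((dvd_pow_self q hb.ne').trans hqM)
    have hq0 : (q : ℝ) ≠ 0 := by exact_mod_cast hq.ne_zero
    have hM1 : (q : ℝ) ^ 2 * Complex.normSq y = M := by
      rw [← hM]
      simp [sq]
    obtain ⟨M', hM'⟩ := e.exists_normSq_eq_natCast hy ((M : ℚ) / q ^ 2) (by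
      push_cast
      rw [← hM1]
      field_simp)
    have hM2 : M = M' * q ^ 2 := by
      have : (q : ℚ) ≠ 0 := by exact_mod_cast hq.ne_zero
      field_simp at hM'
      exact_mod_cast hM'.symm
    have hM3 : Complex.normSq y = M' := by
      rw [hM2, mul_comm M'] at hM1
      push_cast at hM1
      exact mul_left_cancel₀ (pow_ne_zero 2 hq0) hM1
    obtain ⟨z, hz, rfl⟩ := ih (b - 2) (by omega) hy hM3 (by
      rcases Nat.lt_or_ge b 2 with h | h
      · simp [Nat.sub_eq_zero_of_le h.le]
      · rw [← Nat.sub_add_cancel h, add_comm, pow_add, hM2, mul_comm M'] at hqM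
        exact Nat.dvd_of_mul_dvd_mul_left (pow_pos hq.pos 2) hqM)
    refine ⟨z, hz, ?_⟩
    have : (b + 1) / 2 = (b - 2 + 1) / 2 + 1 := by omega
    rw [this]
    ring

end AddChar

lemma exists_eq_mul_of_isCoprime (S : Subalgebra ℤ ℂ) {x y : ℂ} (hx : x ∈ S) (hy : y ∈ S) {d e : ℤ}
    (hde : IsCoprime d e) (h : d * y = e * x) : ∃ w ∈ S, x = d * w := by
  obtain ⟨u, v, huv⟩ := hde
  refine ⟨u * x + v * y, ?_, ?_⟩
  · exact S.add_mem (S.mul_mem (by simp) hx) (S.mul_mem (by simp) hy)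
  · have : (u : ℂ) * d + v * e = 1 := by exact_mod_cast huv
    linear_combination (-x) * this - (v : ℂ) * h

/-- A relation `conj y * (x - y) = -l` determines the ratio `y / x` up to a sign. -/
lemma two_mul_eq_or_of_conj_mul_sub {x y : ℂ} {l : ℝ} (hx : x ≠ 0)
    (h : starRingEnd ℂ y * (x - y) = -l) {a b : ℝ} (ha : a ≠ 0)
    (hab : 1 + 4 * l / Complex.normSq x = (b / a) ^ 2) :
    2 * (a : ℂ) * y = (a + b) * x ∨ 2 * (a : ℂ) * y = (a - b) * x := by
  have hX : Complex.normSq x ≠ 0 := by simpa using hx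
  set X := Complex.normSq x with hXdef
  set s := Complex.normSq y - l with hs
  have h1 : starRingEnd ℂ y * x = s := by
    have h2 := Complex.mul_conj y
    rw [hs]
    push_cast
    linear_combination h + h2
  have h2 : y * starRingEnd ℂ x = s := by
    have := congrArg (starRingEnd ℂ) h1
    simpa using this
  have h3 : y * X = s * x := by
    rw [hXdef, ← Complex.mul_conj, ← h2]
    ring
  have h4 : (s + l) * X = s ^ 2 := by
    have h5 : (((s + l) * X : ℝ) : ℂ) = ((s ^ 2 : ℝ) : ℂ) := by
      have h6 : ((s + l : ℝ) : ℂ) = y * starRingEnd ℂ y := by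
        rw [Complex.mul_conj, hs]
        simp
      rw [Complex.ofReal_mul, h6, hXdef, ← Complex.mul_conj, Complex.ofReal_pow, sq]
      nth_rw 1 [← h1]
      rw [← h2]
      ring
    exact_mod_cast h5
  have h5 : (2 * a * s - a * X - b * X) * (2 * a * s - a * X + b * X) = 0 := by
    field_simp at hab
    linear_combination (-4 * a ^ 2) * h4 + X * hab
  have hXC : (X : ℂ) ≠ 0 := by exact_mod_cast hX
  rcases mul_eq_zero.1 h5 with h6 | h6
  · left
    have h7 : 2 * (a : ℂ) * s - a * X - b * X = 0 := by exact_mod_cast h6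
    apply mul_left_cancel₀ hXC
    linear_combination 2 * (a : ℂ) * h3 + x * h7
  · right
    have h7 : 2 * (a : ℂ) * s - a * X + b * X = 0 := by exact_mod_cast h6
    apply mul_left_cancel₀ hXC
    linear_combination 2 * (a : ℂ) * h3 + x * h7

/-- The bound on `p` coming from a relation `conj y * (x - y) = -l` with `x ≠ 0` in `ℤ[ζ]`. -/
lemma prime_le_of_conj_mul_sub {n p k : ℕ} [Fact p.Prime] [NeZero n] (hn : n = p ^ (k + 1)) {ζ : ℂ}
    (hζ : IsPrimitiveRoot ζ n) {x y : ℂ}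
    (hxR : x ∈ (AddChar.zmodChar _ hζ.pow_eq_one).groupRingEval.range)
    (hyR : y ∈ (AddChar.zmodChar _ hζ.pow_eq_one).groupRingEval.range) (hx : x ≠ 0) {l a b g : ℕ}
    (h : starRingEnd ℂ y * (x - y) = -(l : ℝ)) (ha : 0 < a) (hlt : a < b)
    (hab : 1 + 4 * (l : ℝ) / Complex.normSq x = ((b : ℝ) / a) ^ 2)
    (hg : Nat.gcd (a + b) (2 * a) = g)
    (hsq : ¬ IsSquare (((g : ℚ) ^ 2 * l) / ((b : ℚ) ^ 2 - (a : ℚ) ^ 2))) :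
    (p : ℝ) ≤ ((g : ℝ) ^ 2 * l / ((b : ℝ) ^ 2 - (a : ℝ) ^ 2)) ^ 2 +
      (g : ℝ) ^ 2 * l / ((b : ℝ) ^ 2 - (a : ℝ) ^ 2) + 1 := by
  have hg0 : 0 < g := hg ▸ Nat.gcd_pos_of_pos_left _ (by omega)
  obtain ⟨e, he⟩ : g ∣ a + b := hg ▸ Nat.gcd_dvd_left _ _
  obtain ⟨d, hd⟩ : g ∣ 2 * a := hg ▸ Nat.gcd_dvd_right _ _
  have hcop : Nat.Coprime e d := by
    rw [he, hd, Nat.gcd_mul_left] at hg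
    exact Nat.eq_of_mul_eq_mul_left hg0 (by rw [hg, mul_one])
  have hcop' : IsCoprime (d : ℤ) (e : ℤ) := (Nat.isCoprime_iff_coprime.2 hcop).symm
  have hgC : (g : ℂ) ≠ 0 := by exact_mod_cast hg0.ne'
  have heC : (a : ℂ) + b = g * e := by exact_mod_cast he
  have hdC : 2 * (a : ℂ) = g * d := by exact_mod_cast hd
  obtain ⟨w, hw, hxw⟩ : ∃ w ∈ (AddChar.zmodChar _ hζ.pow_eq_one).groupRingEval.range,
      x = (d : ℤ) * w := by
    rcases two_mul_eq_or_of_conj_mul_sub hx (by exact_mod_cast h)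
      (show (a : ℝ) ≠ 0 by exact_mod_cast ha.ne') hab with h1 | h1
    · refine exists_eq_mul_of_isCoprime _ hxR hyR hcop' ?_
      apply mul_left_cancel₀ hgC
      push_cast at h1 ⊢
      linear_combination h1 - y * hdC + x * heC
    · refine exists_eq_mul_of_isCoprime _ hxR hyR (e := d - e) ?_ ?_
      · have := hcop'.neg_right.add_mul_left_right 1
        rwa [mul_one, neg_add_eq_sub] at this
      · apply mul_left_cancel₀ hgC
        push_cast at h1 ⊢
        linear_combination h1 - y * hdC - x * heC + x * hdC
  have hd0 : 0 < d := Nat.pos_of_mul_pos_left (hd ▸ (by omega : 0 < 2 * a))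
  have hba : (a : ℝ) < b := by exact_mod_cast hlt
  have haR : (0 : ℝ) < a := by exact_mod_cast ha
  have hdR : (d : ℝ) ≠ 0 := by exact_mod_cast hd0.ne'
  have hsub : (b : ℝ) ^ 2 - (a : ℝ) ^ 2 ≠ 0 := by nlinarith
  have hX : Complex.normSq x = (d : ℝ) ^ 2 * Complex.normSq w := by
    rw [hxw]
    simp [sq]
  have hX0 : Complex.normSq x ≠ 0 := by simpa using hx
  have hnorm : Complex.normSq w = (g : ℝ) ^ 2 * l / ((b : ℝ) ^ 2 - (a : ℝ) ^ 2) := by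
    have hdR' : 2 * (a : ℝ) = g * d := by exact_mod_cast hd
    rw [eq_div_iff hsub]
    apply mul_left_cancel₀ (pow_ne_zero 2 hdR)
    have h2 : Complex.normSq x * ((b : ℝ) ^ 2 - (a : ℝ) ^ 2) = 4 * a ^ 2 * l := by
      field_simp at hab
      linear_combination -hab
    rw [hX] at h2
    linear_combination h2 + l * (2 * a + g * d) * hdR'
  obtain ⟨M, hM⟩ := AddChar.exists_normSq_eq_natCast _ hw
    (((g : ℚ) ^ 2 * l) / ((b : ℚ) ^ 2 - (a : ℚ) ^ 2)) (by rw [hnorm]; push_cast; rfl)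
  have hMR : (M : ℝ) = (g : ℝ) ^ 2 * l / ((b : ℝ) ^ 2 - (a : ℝ) ^ 2) := by
    have := congrArg (Rat.cast : ℚ → ℝ) hM
    push_cast at this
    exact this
  rw [← hMR] at hnorm ⊢
  have hsqM : ¬ IsSquare M := fun h => hsq (hM ▸ h.map (Nat.castRingHom ℚ))
  exact_mod_cast prime_le_of_normSq_eq hn hζ hw M hnorm hsqM

lemma MonoidHom.conj_apply_of_finite {G : Type*} [CommGroup G] [Finite G] (χ : G →* ℂ) (g : G) :
    starRingEnd ℂ (χ g) = χ g⁻¹ := by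
  have h1 : ‖χ g‖ = 1 := by
    refine Complex.norm_eq_one_of_pow_eq_one (n := Nat.card G) ?_ Nat.card_pos.ne'
    rw [← map_pow, pow_card_eq_one', map_one]
  have h2 : χ g * χ g⁻¹ = 1 := by rw [← map_mul, mul_inv_cancel, map_one]
  rw [← Complex.inv_eq_conj h1]
  exact inv_eq_of_mul_eq_one_right h2

/-- The defining equation of an SEDF evaluated at a nonprincipal character. -/
lemma IsSEDF.conj_sum_mul_sub {G : Type*} [CommGroup G] [Fintype G] [DecidableEq G]
    {m k lam : ℕ} {D : Fin m → Finset G} (h : IsSEDF D k lam) {χ : G →* ℂ} (hχ : χ ≠ 1)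
    (j : Fin m) :
    starRingEnd ℂ (∑ g ∈ D j, χ g) *
      (∑ g ∈ Finset.univ.biUnion D, χ g - ∑ g ∈ D j, χ g) = -((lam : ℝ) : ℂ) := by
  obtain ⟨-, -, -, -, hdisj, hdiff⟩ := h
  have h1 : ∑ g ∈ Finset.univ.biUnion D, χ g - ∑ g ∈ D j, χ g =
      ∑ l ∈ Finset.univ.filter (fun l => l ≠ j), ∑ g ∈ D l, χ g := by
    rw [Finset.sum_biUnion fun i _ i' _ hii => hdisj i i' hii,
      ← Finset.add_sum_erase _ _ (Finset.mem_univ j), add_sub_cancel_left, Finset.filter_ne']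
  have h2 : ∀ l, starRingEnd ℂ (∑ g ∈ D j, χ g) * ∑ g ∈ D l, χ g =
      ∑ g, ((((D l) ×ˢ (D j)).filter (fun x => x.1 * x.2⁻¹ = g)).card : ℂ) * χ g := by
    intro l
    have h3 : ∀ g, ((((D l) ×ˢ (D j)).filter (fun x => x.1 * x.2⁻¹ = g)).card : ℂ) * χ g =
        ∑ x ∈ ((D l) ×ˢ (D j)).filter (fun x => x.1 * x.2⁻¹ = g), χ (x.1 * x.2⁻¹) := by
      intro g
      rw [← nsmul_eq_mul, ← Finset.sum_const]
      exact Finset.sum_congr rfl fun x hx => by rw [(Finset.mem_filter.1 hx).2]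
    simp_rw [h3]
    rw [Finset.sum_fiberwise, Finset.sum_product, mul_comm, map_sum, Finset.sum_mul_sum]
    simp_rw [map_mul, χ.conj_apply_of_finite]
  rw [h1, Finset.mul_sum]
  simp_rw [h2]
  rw [Finset.sum_comm]
  simp_rw [← Finset.sum_mul]
  have h4 : ∀ g, ∑ l ∈ Finset.univ.filter (fun l => l ≠ j),
      ((((D l) ×ˢ (D j)).filter (fun x => x.1 * x.2⁻¹ = g)).card : ℂ) =
      (lam : ℂ) - if g = 1 then (lam : ℂ) else 0 := by
    intro g
    have := congrArg (Nat.cast : ℕ → ℂ) (hdiff j g)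
    rw [Nat.cast_sum] at this
    rw [this]
    split_ifs <;> simp
  simp_rw [h4, sub_mul]
  rw [Finset.sum_sub_distrib, ← Finset.mul_sum, sum_hom_units_eq_zero χ hχ]
  simp [ite_mul]

/-- Bounds for prime divisors of `v`: let `{D_1,…,D_m}` be a `(v,m,k,λ)`-SEDF with
`m ≥ 3`, let `p > 2` be a prime divisor of `v` with `p ∤ λ`, let `χ` be a nonprincipal
character of order `p^a`, let `q` be a prime divisor of `λ` with `q^b ∣ λ`, `q`
self-conjugate modulo `p^a`, and suppose `λ` is not a perfect square.  Then:
(i) if `χ(D) = 0` then `p ≤ N² + N + 1` with `N = λ/q^{2⌊(b+1)/2⌋}`;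
(ii) if `χ(D) ≠ 0` then, for `a_χ < b_χ` the coprime positive integers with
`1 + 4λ/|χ(D)|² = (b_χ/a_χ)²`, and assuming `4λ/(b_χ²-a_χ²)` is not a perfect square,
`p ≤ M² + M + 1`, where `M = λ/(b_χ²-a_χ²)` if `gcd(a_χ+b_χ, 2a_χ) = 1` and
`M = 4λ/(b_χ²-a_χ²)` if `gcd(a_χ+b_χ, 2a_χ) = 2`. -/
theorem sedf_prime_divisor_bound {G : Type*} [CommGroup G] [Fintype G] [DecidableEq G]
    {v m k lam : ℕ} (hv : Fintype.card G = v)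
    (D : Fin m → Finset G) (h : IsSEDF D k lam) (hm : 3 ≤ m)
    (p : ℕ) (hp : p.Prime) (hp2 : 2 < p) (hpv : p ∣ v) (hplam : ¬ p ∣ lam)
    (a : ℕ) (χ : G →* ℂ) (hχ : χ ≠ 1) (hord : orderOf χ = p ^ a)
    (q b : ℕ) (hq : q.Prime) (hqlam : q ∣ lam) (hqb : q ^ b ∣ lam)
    (hsc : SelfConjPrime q (p ^ a))
    (hlam : ¬ IsSquare lam) :
    ((∑ g ∈ Finset.univ.biUnion D, χ g) = 0 →
      (p : ℝ) ≤ ((lam : ℝ) / q ^ (2 * ((b + 1) / 2))) ^ 2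
        + (lam : ℝ) / q ^ (2 * ((b + 1) / 2)) + 1) ∧
    ((∑ g ∈ Finset.univ.biUnion D, χ g) ≠ 0 →
      ∀ aχ bχ : ℕ, 0 < aχ → aχ < bχ → Nat.Coprime aχ bχ →
        (1 + 4 * (lam : ℝ) / Complex.normSq (∑ g ∈ Finset.univ.biUnion D, χ g)
          = ((bχ : ℝ) / (aχ : ℝ)) ^ 2) →
        ¬ IsSquare ((4 * lam : ℚ) / ((bχ : ℚ) ^ 2 - (aχ : ℚ) ^ 2)) →
        ((Nat.gcd (aχ + bχ) (2 * aχ) = 1 →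
          (p : ℝ) ≤ ((lam : ℝ) / ((bχ : ℝ) ^ 2 - (aχ : ℝ) ^ 2)) ^ 2
            + (lam : ℝ) / ((bχ : ℝ) ^ 2 - (aχ : ℝ) ^ 2) + 1) ∧
         (Nat.gcd (aχ + bχ) (2 * aχ) = 2 →
          (p : ℝ) ≤ (4 * (lam : ℝ) / ((bχ : ℝ) ^ 2 - (aχ : ℝ) ^ 2)) ^ 2
            + 4 * (lam : ℝ) / ((bχ : ℝ) ^ 2 - (aχ : ℝ) ^ 2) + 1))) := by
  have hpF : Fact p.Prime := ⟨hp⟩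
  obtain ⟨k', rfl⟩ : ∃ k', a = k' + 1 := by
    refine Nat.exists_eq_succ_of_ne_zero ?_
    rintro rfl
    exact hχ (orderOf_eq_one_iff.1 (by rw [hord, pow_zero]))
  obtain ⟨n, hn⟩ : ∃ n, n = p ^ (k' + 1) := ⟨_, rfl⟩
  rw [← hn] at hord hsc
  have hpn : p ≤ n := hn ▸ Nat.le_self_pow (by omega) p
  have hn2 : 2 < n := by omega
  have : NeZero n := ⟨by omega⟩
  have hζ := Complex.isPrimitiveRoot_exp n (NeZero.ne n)
  set ζ := Complex.exp (2 * Real.pi * Complex.I / n)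
  let e := AddChar.zmodChar n hζ.pow_eq_one
  have hmem : ∀ S : Finset G, ∑ g ∈ S, χ g ∈ e.groupRingEval.range := by
    intro S
    refine Subalgebra.sum_mem _ fun g _ => ?_
    have h1 : χ g ^ n = 1 := by
      rw [← MonoidHom.pow_apply, ← hord, pow_orderOf_eq_one, MonoidHom.one_apply]
    obtain ⟨i, -, hi⟩ := hζ.eq_pow_of_pow_eq_one h1
    rw [← hi, ← AddChar.zmodChar_apply' hζ.pow_eq_one]
    exact e.apply_mem_range_groupRingEval _
  have hsedf := h.conj_sum_mul_sub hχ ⟨0, by omega⟩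
  set y := ∑ g ∈ D ⟨0, by omega⟩, χ g with hy
  have hyR : y ∈ e.groupRingEval.range := hmem _
  have hxR := hmem (Finset.univ.biUnion D)
  set x := ∑ g ∈ Finset.univ.biUnion D, χ g with hx
  constructor
  · intro hx0
    have hnorm : Complex.normSq y = lam := by
      rw [hx0, zero_sub, mul_neg, neg_inj, mul_comm, Complex.mul_conj] at hsedf
      exact_mod_cast hsedf
    have hqp : q ≠ p := by
      rintro rfl
      exact hplam hqlam
    obtain ⟨r, hr⟩ := hsc
    have hfac : n.factorization q = 0 := by
      rw [hn]
      refine Nat.factorization_eq_zero_of_not_dvd fun hdvd => hqp ?_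
      exact (Nat.prime_dvd_prime_iff_eq hq hp).1 (hq.dvd_of_dvd_pow hdvd)
    rw [hfac, pow_zero, Nat.div_one] at hr
    obtain ⟨z, hz, hyz⟩ := e.exists_eq_pow_mul_of_pow_dvd_normSq hn2 hq hr b hyR hnorm hqb
    set c := (b + 1) / 2
    have hq0 : (q : ℝ) ≠ 0 := by exact_mod_cast hq.ne_zero
    have hnormz : Complex.normSq z = lam / (q : ℝ) ^ (2 * c) := by
      rw [eq_div_iff (pow_ne_zero _ hq0), ← hnorm, hyz]
      simp
      ring
    obtain ⟨N, hN⟩ := e.exists_normSq_eq_natCast hz ((lam : ℚ) / q ^ (2 * c))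
      (by rw [hnormz]; push_cast; rfl)
    have hNR : (N : ℝ) = lam / (q : ℝ) ^ (2 * c) := by
      have := congrArg (Rat.cast : ℚ → ℝ) hN
      push_cast at this
      exact this
    rw [← hNR] at hnormz ⊢
    have hNsq : ¬ IsSquare N := by
      rintro ⟨t, ht⟩
      refine hlam ⟨t * q ^ c, ?_⟩
      rw [eq_div_iff (pow_ne_zero _ hq0), ht] at hNR
      have h1 : t * t * q ^ (2 * c) = lam := by exact_mod_cast hNR
      rw [← h1]
      ring
    exact_mod_cast prime_le_of_normSq_eq hn hζ hz N hnormz hNsq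
  · intro hx0 aχ bχ ha hlt _ hab hsq
    refine ⟨fun hg => ?_, fun hg => ?_⟩
    · have h1 := prime_le_of_conj_mul_sub hn hζ hxR hyR hx0 hsedf ha hlt hab hg ?_
      · simpa using h1
      · rintro ⟨t, ht⟩
        refine hsq ⟨2 * t, ?_⟩
        push_cast at ht
        linear_combination 4 * ht
    · have h1 := prime_le_of_conj_mul_sub hn hζ hxR hyR hx0 hsedf ha hlt hab hg ?_
      · norm_num at h1 ⊢
        exact h1
      · norm_num at hsq ⊢
        exact hsq
end
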